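/- For every dimension d ≥ 1 and every ε > 0 there exists N₀ such that for every N ≥ N₀ and every continuous map f from the standard (N−1)-dimensional simplex Δ^{N−1} to ℝ^d, there exists a point c ∈ ℝ^d such that the number of (d+1)-element subsets S of the vertex set of Δ^{N−1} with c ∈ f(conv S) is at least (2d/((d+1)!·(d+1)) − ε) · C(N, d+1). -/

import Mathlib

open Finset

section Tuples

variable {V : Type*} {A : Type*}

/-- Omitting an entry from a tuple that starts with `x`. -/
theorem removeNth_zero_cons' {n : ℕ} (x : V) (t : Fin n → V) :
    (0 : Fin (n + 1)).removeNth (Fin.cons x t : Fin (n + 1) → V) = t := by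
  ext i; simp [Fin.removeNth]

theorem removeNth_succ_cons' {n : ℕ} (x : V) (t : Fin (n + 1) → V) (j : Fin (n + 1)) :
    (j.succ).removeNth (Fin.cons x t : Fin (n + 2) → V) =
      (Fin.cons x (j.removeNth t) : Fin (n + 1) → V) := by
  ext i
  refine Fin.cases ?_ (fun i => ?_) i <;> simp [Fin.removeNth]

/-- The coboundary operator mod 2 on functions of tuples. -/
def cobd {n : ℕ} (c : (Fin n → V) → ZMod 2) (t : Fin (n + 1) → V) : ZMod 2 :=
  ∑ j : Fin (n + 1), c (j.removeNth t)

theorem sum_removeNth_removeNth [AddCommGroup A] (hA : ∀ a : A, a + a = 0) {n : ℕ}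
    (g : (Fin n → V) → A) (u : Fin (n + 2) → V) :
    ∑ j : Fin (n + 2), ∑ i : Fin (n + 1), g (i.removeNth (j.removeNth u)) = 0 := by
  induction n with
  | zero =>
    simp only [Fin.sum_univ_succ, Fin.sum_univ_zero]
    have : ∀ a b : Fin 0 → V, a = b := fun a b => Subsingleton.elim _ _
    simp [this _ (default : Fin 0 → V), hA]
  | succ n ih =>
    obtain ⟨x, t, rfl⟩ : ∃ x t, u = Fin.cons x t := ⟨u 0, Fin.tail u, by simp⟩
    rw [Fin.sum_univ_succ]
    simp only [removeNth_zero_cons', removeNth_succ_cons']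
    have : ∀ j : Fin (n + 2), ∑ i : Fin (n + 2),
        g (i.removeNth (Fin.cons x (j.removeNth t) : Fin (n + 2) → V)) =
        g (j.removeNth t) + ∑ i : Fin (n + 1), g (Fin.cons x (i.removeNth (j.removeNth t))) := by
      intro j
      rw [Fin.sum_univ_succ]
      simp only [removeNth_zero_cons', removeNth_succ_cons']
    simp only [this, sum_add_distrib]
    rw [ih (fun s => g (Fin.cons x s)), add_zero, hA]

theorem cobd_cons {n : ℕ} (c : (Fin (n + 1) → V) → ZMod 2) (x : V) (t : Fin (n + 1) → V) :
    cobd c (Fin.cons x t : Fin (n + 2) → V) = c t + cobd (fun s => c (Fin.cons x s)) t := by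
  simp only [cobd]
  rw [Fin.sum_univ_succ]
  simp only [removeNth_zero_cons', removeNth_succ_cons']

theorem cobd_cobd {n : ℕ} (c : (Fin n → V) → ZMod 2) : cobd (cobd c) = 0 := by
  ext t
  exact sum_removeNth_removeNth (fun a => CharTwo.add_self_eq_zero a) c t

theorem cobd_add {n : ℕ} (c c' : (Fin n → V) → ZMod 2) : cobd (c + c') = cobd c + cobd c' := by
  ext t; simp [cobd, sum_add_distrib]

theorem cobd_sum {n : ℕ} {ι : Type*} (s : Finset ι) (c : ι → (Fin n → V) → ZMod 2) :
    cobd (∑ i ∈ s, c i) = ∑ i ∈ s, cobd (c i) := by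
  ext t
  simp only [cobd, Finset.sum_apply]
  exact sum_comm

end Tuples

section Subdivision
variable {E : Type*} [AddCommGroup E] [Module ℝ E]

/-- The barycenter of a tuple of points. -/
noncomputable def tupleCenter {n : ℕ} (t : Fin n → E) : E := (n : ℝ)⁻¹ • ∑ i, t i

/-- The operator on cochains dual to barycentric subdivision. -/
noncomputable def subdiv : (n : ℕ) → ((Fin n → E) → ZMod 2) → (Fin n → E) → ZMod 2
  | 0, c, t => c t
  | n + 1, c, t => ∑ i : Fin (n + 1),
      subdiv n (fun s => c (Fin.cons (tupleCenter t) s)) (i.removeNth t)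

theorem subdiv_add (n : ℕ) (c c' : (Fin n → E) → ZMod 2) :
    subdiv n (c + c') = subdiv n c + subdiv n c' := by
  induction n with
  | zero => rfl
  | succ n ih =>
    ext t
    simp only [subdiv, Pi.add_apply, ← sum_add_distrib]
    refine sum_congr rfl fun i _ => ?_
    exact congrFun (ih _ _) _

theorem subdiv_zero (n : ℕ) : subdiv n (0 : (Fin n → E) → ZMod 2) = 0 := by
  have := subdiv_add n (0 : (Fin n → E) → ZMod 2) 0
  simpa using this

theorem subdiv_sum (n : ℕ) {ι : Type*} (s : Finset ι) (c : ι → (Fin n → E) → ZMod 2) :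
    subdiv n (∑ i ∈ s, c i) = ∑ i ∈ s, subdiv n (c i) := by
  classical
  induction s using Finset.induction_on with
  | empty => simp [subdiv_zero]
  | insert a s ha ih => rw [sum_insert ha, sum_insert ha, subdiv_add, ih]

theorem cobd_subdiv (n : ℕ) (c : (Fin n → E) → ZMod 2) :
    subdiv (n + 1) (cobd c) = cobd (subdiv n c) := by
  induction n with
  | zero =>
    ext t
    simp only [subdiv, cobd]
    simp
  | succ n ih =>
    ext t
    rw [subdiv]
    have : (fun s : Fin (n + 1) → E => cobd c (Fin.cons (tupleCenter t) s : Fin (n + 2) → E)) =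
        c + cobd (fun s => c (Fin.cons (tupleCenter t) s)) := by
      ext s
      exact cobd_cons c _ s
    simp only [this, subdiv_add, Pi.add_apply, sum_add_distrib, ih]
    change cobd (subdiv (n + 1) c) t + cobd (cobd _) t = _
    rw [cobd_cobd]
    simp

theorem subdiv_one (c : (Fin 1 → E) → ZMod 2) : subdiv 1 c = c := by
  ext t
  simp only [subdiv, Fin.sum_univ_succ, Fin.sum_univ_zero, add_zero]
  congr 1
  ext i
  fin_cases i
  simp [tupleCenter]

end Subdivision

section SubdivisionSupport
variable {E : Type*} [NormedAddCommGroup E] [NormedSpace ℝ E]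

theorem dist_tupleCenter_le {n : ℕ} (t : Fin (n + 1) → E) {D : ℝ}
    (hD : ∀ i j, dist (t i) (t j) ≤ D) (k : Fin (n + 1)) :
    dist (tupleCenter t) (t k) ≤ (1 - 1 / ((n : ℝ) + 1)) * D := by
  have hn : (0 : ℝ) < (n : ℝ) + 1 := by positivity
  have h1 : tupleCenter t - t k = ((n : ℝ) + 1)⁻¹ • ∑ i, (t i - t k) := by
    rw [sum_sub_distrib, smul_sub]
    simp only [tupleCenter, sum_const, card_univ, Fintype.card_fin]
    rw [← Nat.cast_smul_eq_nsmul ℝ, smul_smul]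
    push_cast
    rw [inv_mul_cancel₀ hn.ne', one_smul]
  have h2 : ‖∑ i, (t i - t k)‖ ≤ n * D := by
    rw [Fin.sum_univ_succAbove _ k, sub_self, zero_add]
    refine (norm_sum_le _ _).trans ?_
    refine (sum_le_sum fun i _ => (dist_eq_norm (t (k.succAbove i)) (t k)) ▸ hD _ _).trans ?_
    simp
  rw [dist_eq_norm, h1, norm_smul, norm_inv, Real.norm_of_nonneg hn.le]
  calc ((n : ℝ) + 1)⁻¹ * ‖∑ i, (t i - t k)‖ ≤ ((n : ℝ) + 1)⁻¹ * (n * D) := by gcongr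
    _ = _ := by field_simp; ring

theorem exists_of_subdiv_ne_zero (M : ℕ) (n : ℕ) (hn : n ≤ M) (c : (Fin n → E) → ZMod 2)
    (t : Fin n → E) {D : ℝ} (hD0 : 0 ≤ D) (hD : ∀ i j, dist (t i) (t j) ≤ D)
    (h : subdiv n c t ≠ 0) :
    ∃ s : Fin n → E, c s ≠ 0 ∧ (∀ i, s i ∈ convexHull ℝ (Set.range t)) ∧
      ∀ i j, dist (s i) (s j) ≤ (1 - 1 / (M : ℝ)) * D := by
  induction n with
  | zero => exact ⟨t, h, fun i => i.elim0, fun i => i.elim0⟩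
  | succ n ih =>
    obtain ⟨i, -, hi⟩ := exists_ne_zero_of_sum_ne_zero h
    obtain ⟨s, hs, hconv, hdist⟩ := ih (by omega) _ (i.removeNth t) (fun a b => hD _ _) hi
    have hconv' : ∀ j, s j ∈ convexHull ℝ (Set.range t) := fun j =>
      convexHull_mono (by rintro _ ⟨k, rfl⟩; exact ⟨_, rfl⟩) (hconv j)
    have hM : (1 - 1 / ((n : ℝ) + 1)) * D ≤ (1 - 1 / (M : ℝ)) * D := by
      have : ((n : ℝ) + 1) ≤ M := by exact_mod_cast hn
      gcongr
    have hcenter : ∀ j, dist (tupleCenter t) (s j) ≤ (1 - 1 / (M : ℝ)) * D := fun j => by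
      have hsub : convexHull ℝ (Set.range t) ⊆
          Metric.closedBall (tupleCenter t) ((1 - 1 / (M : ℝ)) * D) := by
        refine convexHull_min ?_ (convex_closedBall _ _)
        rintro _ ⟨k, rfl⟩
        rw [Metric.mem_closedBall, dist_comm]
        exact (dist_tupleCenter_le t hD k).trans hM
      have := hsub (hconv' j)
      rwa [Metric.mem_closedBall, dist_comm] at this
    have hself : 0 ≤ (1 - 1 / (M : ℝ)) * D := by
      refine mul_nonneg (sub_nonneg.2 ?_) hD0
      have : (1 : ℝ) ≤ M := by exact_mod_cast (by omega : 1 ≤ M)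
      rw [div_le_one (by linarith)]
      exact this
    refine ⟨Fin.cons (tupleCenter t) s, hs, fun j => ?_, fun a b => ?_⟩
    · refine Fin.cases ?_ (fun j => ?_) j
      · simp only [Fin.cons_zero, tupleCenter, smul_sum]
        refine (convex_convexHull ℝ _).sum_mem (fun _ _ => by positivity) ?_
          (fun k _ => subset_convexHull ℝ _ ⟨k, rfl⟩)
        simp
        field_simp
      · simpa using hconv' j
    · refine Fin.cases ?_ (fun a => ?_) a <;> refine Fin.cases ?_ (fun b => ?_) b
      · simpa using hself
      · simpa using hcenter b
      · simpa [dist_comm] using hcenter a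
      · simpa using hdist a b

theorem exists_of_iterate_subdiv_ne_zero (M : ℕ) (n : ℕ) (hn : n ≤ M) (hM : 1 ≤ M) (m : ℕ)
    (c : (Fin n → E) → ZMod 2) (t : Fin n → E) {D : ℝ} (hD0 : 0 ≤ D)
    (hD : ∀ i j, dist (t i) (t j) ≤ D) (h : (subdiv n)^[m] c t ≠ 0) :
    ∃ s : Fin n → E, c s ≠ 0 ∧ (∀ i, s i ∈ convexHull ℝ (Set.range t)) ∧
      ∀ i j, dist (s i) (s j) ≤ (1 - 1 / (M : ℝ)) ^ m * D := by
  induction m generalizing c with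
  | zero => exact ⟨t, h, fun i => subset_convexHull ℝ _ ⟨i, rfl⟩, by simpa using hD⟩
  | succ m ih =>
    rw [Function.iterate_succ_apply] at h
    obtain ⟨s, hs, hconv, hdist⟩ := ih _ h
    have h1 : (0 : ℝ) ≤ 1 - 1 / (M : ℝ) := by
      have : (1 : ℝ) ≤ M := by exact_mod_cast hM
      rw [sub_nonneg, div_le_one (by linarith)]
      exact this
    obtain ⟨s', hs', hconv', hdist'⟩ :=
      exists_of_subdiv_ne_zero M n hn c s (by positivity) hdist hs
    refine ⟨s', hs', fun i => ?_, fun i j => (hdist' i j).trans_eq (by rw [pow_succ]; ring)⟩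
    exact convexHull_min (by rintro _ ⟨k, rfl⟩; exact hconv k) (convex_convexHull ℝ _) (hconv' i)

theorem cobd_iterate_subdiv {n : ℕ} (m : ℕ) (c : (Fin n → E) → ZMod 2) :
    (subdiv (n + 1))^[m] (cobd c) = cobd ((subdiv n)^[m] c) := by
  induction m generalizing c with
  | zero => rfl
  | succ m ih => rw [Function.iterate_succ_apply, Function.iterate_succ_apply, cobd_subdiv, ih]

theorem iterate_subdiv_sum {n : ℕ} (m : ℕ) {ι : Type*} (s : Finset ι)
    (c : ι → (Fin n → E) → ZMod 2) :
    (subdiv n)^[m] (∑ i ∈ s, c i) = ∑ i ∈ s, (subdiv n)^[m] (c i) := by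
  induction m generalizing c with
  | zero => rfl
  | succ m ih => simp only [Function.iterate_succ_apply, subdiv_sum, ih]

end SubdivisionSupport

section Pairing
variable {U X : Type*}

/-- The product of the classes `δ (h i), δ (h (i + 1)), …` evaluated on the product of a `P`-tuple
and a `Q`-tuple. -/
def pairing (h : ℕ → U → X → ZMod 2) :
    (i P Q : ℕ) → (Fin P → U) → (Fin Q → X) → ZMod 2
  | _, 0, _, _, _ => 0
  | _, _ + 1, 0, _, _ => 0
  | i, P + 1, Q + 1, u, x =>
    if P = 0 ∧ Q = 0 then 1 else
      (h i (u 0) (x 0) + h i (u 1) (x 0)) * pairing h (i + 1) P (Q + 1) (Fin.tail u) x +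
      (h i (u 0) (x 0) + h i (u 0) (x 1)) * pairing h (i + 1) (P + 1) Q u (Fin.tail x)
  termination_by _ P Q => P + Q

variable (h : ℕ → U → X → ZMod 2)

@[simp] theorem pairing_zero_left (i Q : ℕ) (u : Fin 0 → U) (x : Fin Q → X) :
    pairing h i 0 Q u x = 0 := by rw [pairing]

@[simp] theorem pairing_zero_right (i P : ℕ) (u : Fin P → U) (x : Fin 0 → X) :
    pairing h i P 0 u x = 0 := by cases P <;> rw [pairing]

@[simp] theorem pairing_one_one (i : ℕ) (u : Fin 1 → U) (x : Fin 1 → X) :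
    pairing h i 1 1 u x = 1 := by rw [pairing]; simp

theorem pairing_succ_succ (i P Q : ℕ) (hPQ : ¬(P = 0 ∧ Q = 0)) (u : Fin (P + 1) → U)
    (x : Fin (Q + 1) → X) : pairing h i (P + 1) (Q + 1) u x =
      (h i (u 0) (x 0) + h i (u 1) (x 0)) * pairing h (i + 1) P (Q + 1) (Fin.tail u) x +
      (h i (u 0) (x 0) + h i (u 0) (x 1)) * pairing h (i + 1) (P + 1) Q u (Fin.tail x) := by
  rw [pairing, if_neg hPQ]

theorem pairing_swap (i P Q : ℕ) (u : Fin P → U) (x : Fin Q → X) :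
    pairing h i P Q u x = pairing (fun i x u => h i u x) i Q P x u := by
  induction hm : P + Q generalizing i P Q with
  | zero =>
    obtain rfl : P = 0 := by omega
    simp
  | succ m ih =>
    rcases P with _ | P
    · simp
    rcases Q with _ | Q
    · simp
    by_cases hPQ : P = 0 ∧ Q = 0
    · obtain ⟨rfl, rfl⟩ := hPQ
      simp
    · rw [pairing_succ_succ h i P Q hPQ, pairing_succ_succ _ i Q P (by tauto),
        ih _ _ _ _ _ (by omega), ih _ _ _ _ _ (by omega), add_comm]

theorem pairing_eq_zero_of_const (i P Q k : ℕ) (hik : i ≤ k) (hk : k + 2 < i + P + Q)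
    (u : Fin P → U) (x : Fin Q → X)
    (hc : ∀ a b a' b', h k (u a) (x b) = h k (u a') (x b')) : pairing h i P Q u x = 0 := by
  induction hm : P + Q generalizing i P Q with
  | zero =>
    obtain rfl : P = 0 := by omega
    simp
  | succ m ih =>
    rcases P with _ | P
    · simp
    rcases Q with _ | Q
    · simp
    rw [pairing_succ_succ h i P Q (by omega)]
    rcases hik.eq_or_lt with rfl | hlt
    · rw [hc 1 0 0 0, hc 0 1 0 0]
      simp [CharTwo.add_self_eq_zero]
    · rw [ih (i + 1) P (Q + 1) hlt (by omega) (Fin.tail u) x (fun _ _ _ _ => hc _ _ _ _)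
          (by omega),
        ih (i + 1) (P + 1) Q hlt (by omega) u (Fin.tail x) (fun _ _ _ _ => hc _ _ _ _) (by omega)]
      simp

theorem pairing_one_right (i P : ℕ) (u : Fin (P + 1) → U) (x : Fin 1 → X) :
    pairing h i (P + 1) 1 u x =
      ∏ k : Fin P, (h (i + k) (u k.castSucc) (x 0) + h (i + k) (u k.succ) (x 0)) := by
  induction P generalizing i with
  | zero => simp
  | succ P ih =>
    rw [pairing_succ_succ h i (P + 1) 0 (by omega), ih, Fin.prod_univ_succ]
    simp only [pairing_zero_right, mul_zero, add_zero]
    congr 1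
    refine prod_congr rfl fun k _ => ?_
    simp only [Fin.tail, Fin.val_succ, Fin.succ_castSucc]
    rw [show i + 1 + (k : ℕ) = i + (k + 1) by ring]

theorem sum_mul_removeNth {n : ℕ} (ψ : U → ZMod 2) (g : (Fin (n + 1) → U) → ZMod 2)
    (u : Fin (n + 2) → U) :
    ∑ j : Fin (n + 2), ψ (j.removeNth u 0) * g (j.removeNth u) =
      ψ (u 0) * ∑ j : Fin (n + 2), g (j.removeNth u) + (ψ (u 0) + ψ (u 1)) * g (Fin.tail u) := by
  obtain ⟨a, t, rfl⟩ : ∃ a t, u = Fin.cons a t := ⟨u 0, Fin.tail u, by simp⟩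
  have h0 := cobd_cons g a t
  simp only [cobd] at h0
  rw [h0, Fin.sum_univ_succ]
  have h1 : (Fin.cons a t : Fin (n + 2) → U) 1 = t 0 := rfl
  simp only [removeNth_zero_cons', removeNth_succ_cons', Fin.cons_zero, Fin.tail_cons, h1, mul_add,
    mul_sum, add_mul]
  linear_combination (-ψ a * g t) * (CharTwo.two_eq_zero : (2 : ZMod 2) = 0)

theorem sum_mul_tail_removeNth {n : ℕ} (φ : U → ZMod 2) (g : (Fin (n + 1) → U) → ZMod 2)
    (u : Fin (n + 3) → U) :
    ∑ j : Fin (n + 3), (φ (j.removeNth u 0) + φ (j.removeNth u 1)) * g (Fin.tail (j.removeNth u)) =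
      (φ (u 0) + φ (u 1)) * ∑ j : Fin (n + 2), g (j.removeNth (Fin.tail u)) := by
  obtain ⟨a, t, rfl⟩ : ∃ a t, u = Fin.cons a t := ⟨u 0, Fin.tail u, by simp⟩
  obtain ⟨b, s, rfl⟩ : ∃ b s, t = Fin.cons b s := ⟨t 0, Fin.tail t, by simp⟩
  simp only [Fin.tail_cons]
  have h0 := cobd_cons g b s
  simp only [cobd] at h0
  rw [h0, Fin.sum_univ_succ, Fin.sum_univ_succ]
  have h1 : ∀ v : Fin (n + 2) → U, (Fin.cons a v : Fin (n + 3) → U) 1 = v 0 := fun v => rfl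
  have h2 : ∀ v : Fin (n + 1) → U, (Fin.cons a v : Fin (n + 2) → U) 1 = v 0 := fun v => rfl
  have h3 : ∀ v : Fin (n + 1) → U, (Fin.cons b v : Fin (n + 2) → U) 1 = v 0 := fun v => rfl
  simp only [removeNth_zero_cons', removeNth_succ_cons', Fin.cons_zero, Fin.tail_cons, h1, h2, h3,
    mul_add, mul_sum]
  linear_combination (φ (s 0) * g s) * (CharTwo.two_eq_zero : (2 : ZMod 2) = 0)

theorem sum_pairing_removeNth (i P Q : ℕ) (hPQ : ¬(P = 0 ∧ Q = 0)) (u : Fin (P + 2) → U)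
    (x : Fin (Q + 1) → X) :
    ∑ j : Fin (P + 2), pairing h i (P + 1) (Q + 1) (j.removeNth u) x =
      (h i (u 0) (x 0) + h i (u 1) (x 0)) *
        ∑ j : Fin (P + 1), pairing h (i + 1) P (Q + 1) (j.removeNth (Fin.tail u)) x +
      (h i (u 0) (x 0) + h i (u 0) (x 1)) *
        ∑ j : Fin (P + 2), pairing h (i + 1) (P + 1) Q (j.removeNth u) (Fin.tail x) +
      (h i (u 0) (x 0) + h i (u 0) (x 1) + (h i (u 1) (x 0) + h i (u 1) (x 1))) *
        pairing h (i + 1) (P + 1) Q (Fin.tail u) (Fin.tail x) := by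
  simp only [pairing_succ_succ h i P Q hPQ, sum_add_distrib]
  rw [sum_mul_removeNth (fun v => h i v (x 0) + h i v (x 1))
    (fun v => pairing h (i + 1) (P + 1) Q v (Fin.tail x)), ← add_assoc]
  congr 2
  rcases P with _ | P
  · simp
  · exact sum_mul_tail_removeNth (fun v => h i v (x 0))
      (fun v => pairing h (i + 1) (P + 1) (Q + 1) v x) u

/-- The total coboundary of `pairing` vanishes. -/
theorem sum_pairing_add_sum_pairing (i P Q : ℕ) (u : Fin (P + 1) → U) (x : Fin (Q + 1) → X) :
    ∑ j : Fin (P + 1), pairing h i P (Q + 1) (j.removeNth u) x +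
      ∑ j : Fin (Q + 1), pairing h i (P + 1) Q u (j.removeNth x) = 0 := by
  have htwo : (2 : ZMod 2) = 0 := CharTwo.two_eq_zero
  have hswap := sum_pairing_removeNth (fun i x u => h i u x)
  simp only [← pairing_swap h] at hswap
  induction hm : P + Q generalizing i P Q with
  | zero =>
    obtain ⟨rfl, rfl⟩ : P = 0 ∧ Q = 0 := by omega
    simp
  | succ m ih =>
    rcases P with _ | P <;> rcases Q with _ | Q
    · simp
    · rcases Q with _ | Q
      · simp [htwo]
      · rw [hswap i (Q + 1) 0 (by omega)]
        have := ih (i + 1) 0 (Q + 1) u (Fin.tail x) (by omega)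
        simp only [pairing_zero_left, sum_const_zero, mul_zero, add_zero, zero_add] at this ⊢
        rw [this, mul_zero]
    · rcases P with _ | P
      · simp [htwo]
      · rw [sum_pairing_removeNth h i (P + 1) 0 (by omega)]
        have := ih (i + 1) (P + 1) 0 (Fin.tail u) x (by omega)
        simp only [pairing_zero_right, sum_const_zero, mul_zero, add_zero] at this ⊢
        rw [this, mul_zero]
    · rw [sum_pairing_removeNth h i P (Q + 1) (by omega), hswap i Q (P + 1) (by omega)]
      have h1 := ih (i + 1) P (Q + 1) (Fin.tail u) x (by omega)
      have h2 := ih (i + 1) (P + 1) Q u (Fin.tail x) (by omega)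
      linear_combination (h i (u 0) (x 0) + h i (u 1) (x 0)) * h1 +
        (h i (u 0) (x 0) + h i (u 0) (x 1)) * h2 +
        ((h i (u 0) (x 0) + h i (u 0) (x 1) + h i (u 1) (x 0) + h i (u 1) (x 1)) *
        pairing h (i + 1) (P + 1) (Q + 1) (Fin.tail u) (Fin.tail x)) * htwo

end Pairing

section Density
variable {N : ℕ}

/-- The proportion of the tuples of elements of `Fin N` on which a cochain does not vanish. -/
noncomputable def density {n : ℕ} (c : (Fin n → Fin N) → ZMod 2) : ℝ :=
  (#{t | c t ≠ 0} : ℝ) / (N : ℝ) ^ n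

theorem density_nonneg {n : ℕ} (c : (Fin n → Fin N) → ZMod 2) : 0 ≤ density c := by
  unfold density; positivity

theorem density_zero {n : ℕ} : density (0 : (Fin n → Fin N) → ZMod 2) = 0 := by
  simp [density]

theorem density_add_le {n : ℕ} (c c' : (Fin n → Fin N) → ZMod 2) :
    density (c + c') ≤ density c + density c' := by
  unfold density
  rw [← add_div]
  gcongr
  norm_cast
  refine le_trans (card_le_card ?_) (card_union_le _ _)
  intro t
  simp only [mem_filter, mem_univ, true_and, mem_union, Pi.add_apply]
  intro h
  by_contra! h'
  exact h (by rw [h'.1, h'.2, add_zero])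

theorem density_sum_le {n : ℕ} {ι : Type*} (s : Finset ι) (c : ι → (Fin n → Fin N) → ZMod 2) :
    density (∑ i ∈ s, c i) ≤ ∑ i ∈ s, density (c i) :=
  le_sum_of_subadditive density density_zero.le density_add_le s c

theorem eq_zero_of_density_nonpos (hN : 0 < N) {n : ℕ} {c : (Fin n → Fin N) → ZMod 2}
    (h : density c ≤ 0) : c = 0 := by
  have h0 : density c = 0 := le_antisymm h (density_nonneg c)
  unfold density at h0
  have hpow : (N : ℝ) ^ n ≠ 0 := by positivity
  rw [div_eq_zero_iff, or_iff_left hpow] at h0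
  norm_cast at h0
  rw [card_eq_zero, filter_eq_empty_iff] at h0
  ext t
  simpa using h0 (mem_univ t)

theorem sum_density_cons (hN : 0 < N) {n : ℕ} (c : (Fin (n + 1) → Fin N) → ZMod 2) :
    ∑ x, density (fun s : Fin n → Fin N => c (Fin.cons x s)) = N * density c := by
  unfold density
  rw [← sum_div, pow_succ]
  have : (∑ x, (#{s : Fin n → Fin N | c (Fin.cons x s) ≠ 0} : ℝ)) = #{t | c t ≠ 0} := by
    norm_cast
    simp only [card_filter]
    rw [← Equiv.sum_comp (Fin.consEquiv fun _ => Fin N), Fintype.sum_prod_type]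
    rfl
  rw [this]
  have : (N : ℝ) ≠ 0 := by positivity
  field_simp

theorem exists_filling (hN : 0 < N) {n : ℕ} (c : (Fin (n + 1) → Fin N) → ZMod 2)
    (hc : cobd c = 0) :
    ∃ b : (Fin n → Fin N) → ZMod 2, cobd b = c ∧ density b ≤ density c := by
  have hne : (univ : Finset (Fin N)).Nonempty := ⟨⟨0, hN⟩, mem_univ _⟩
  obtain ⟨x, -, hx⟩ := exists_le_of_sum_le hne
    (f := fun x => density (fun s : Fin n → Fin N => c (Fin.cons x s)))
    (g := fun _ => density c) (by rw [sum_density_cons hN]; simp)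
  refine ⟨_, ?_, hx⟩
  ext t
  have h := cobd_cons c x t
  rw [hc, Pi.zero_apply] at h
  exact (CharTwo.add_eq_zero.1 h.symm).symm

theorem cobd_one_apply {V : Type*} (b : (Fin 1 → V) → ZMod 2) (t : Fin 2 → V) :
    cobd b t = b (fun _ => t 1) + b (fun _ => t 0) := by
  simp only [cobd, Fin.sum_univ_succ, Fin.sum_univ_zero, add_zero]
  congr 2 <;> ext i <;> fin_cases i <;> rfl

theorem density_cobd_one (hN : 0 < N) (b : (Fin 1 → Fin N) → ZMod 2) :
    density (cobd b) = 2 * density b * (1 - density b) := by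
  set g : Fin N → ZMod 2 := fun i => b (fun _ => i) with hg
  set A : Finset (Fin N) := {i | g i ≠ 0} with hA
  have h1 : #{t : Fin 1 → Fin N | b t ≠ 0} = #A := by
    refine card_bij' (fun t _ => t 0) (fun i _ => fun _ => i) ?_ ?_ ?_ ?_
    · intro t ht
      simp only [mem_filter, mem_univ, true_and, hA, hg] at ht ⊢
      rwa [show (fun _ => t 0) = t from funext fun i => by rw [Subsingleton.elim i 0]]
    · intro i hi
      simpa [hA, hg] using hi
    · intro t _
      ext i
      rw [Subsingleton.elim i 0]
    · intro i _
      rfl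
  have h2 : #{t : Fin 2 → Fin N | cobd b t ≠ 0} = #(A ×ˢ Aᶜ) + #(Aᶜ ×ˢ A) := by
    rw [← card_union_of_disjoint]
    · refine card_bij' (fun t _ => (t 0, t 1)) (fun i _ => ![i.1, i.2]) ?_ ?_ ?_ ?_
      · intro t ht
        simp only [mem_filter, mem_univ, true_and, cobd_one_apply] at ht
        simp only [mem_union, mem_product, mem_compl, hA, mem_filter, mem_univ, true_and, hg]
        generalize b (fun _ => t 0) = x at *
        generalize b (fun _ => t 1) = y at *
        revert x y
        decide
      · rintro ⟨i, j⟩ hij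
        simp only [mem_filter, mem_univ, true_and, cobd_one_apply]
        simp only [mem_union, mem_product, mem_compl, hA, mem_filter, mem_univ, true_and, hg] at hij
        simp only [Matrix.cons_val_zero, Matrix.cons_val_one]
        generalize b (fun _ => i) = x at *
        generalize b (fun _ => j) = y at *
        revert x y
        decide
      · intro t _
        ext i
        fin_cases i <;> rfl
      · intro t _
        rfl
    · rw [disjoint_left]
      rintro ⟨i, j⟩ h h'
      simp only [mem_product, mem_compl] at h h'
      exact h'.1 h.1
  unfold density
  rw [h1, h2]
  have hle : #A ≤ N := by simpa using card_le_univ A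
  simp only [card_product, card_compl, Fintype.card_fin]
  push_cast [Nat.cast_sub hle]
  have : (N : ℝ) ≠ 0 := by positivity
  field_simp
  ring

theorem exists_filling_of_two (hN : 0 < N) (c : (Fin 2 → Fin N) → ZMod 2) (hc : cobd c = 0) :
    ∃ b : (Fin 1 → Fin N) → ZMod 2, cobd b = c ∧ density b ≤ 1 / 2 ∧
      2 * density b * (1 - density b) = density c := by
  obtain ⟨b, hb, -⟩ := exists_filling hN c hc
  by_cases h : density b ≤ 1 / 2
  · exact ⟨b, hb, h, by rw [← density_cobd_one hN, hb]⟩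
  · have hb' : cobd (b + 1) = c := by
      rw [← hb]
      ext t
      simp only [cobd_one_apply, Pi.add_apply, Pi.one_apply]
      generalize b (fun _ => t 0) = x
      generalize b (fun _ => t 1) = y
      revert x y
      decide
    have hd : density (b + 1) = 1 - density b := by
      have h1 := card_filter_add_card_filter_not (s := (univ : Finset (Fin 1 → Fin N)))
        (fun t => b t ≠ 0)
      have h2 : #{t : Fin 1 → Fin N | (b + 1) t ≠ 0} = #{t : Fin 1 → Fin N | ¬ b t ≠ 0} := by
        congr 1
        ext t
        simp only [mem_filter, mem_univ, true_and, Pi.add_apply, Pi.one_apply]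
        generalize b t = x
        revert x
        decide
      unfold density
      rw [h2]
      simp only [card_univ, Fintype.card_pi, Fintype.card_fin, prod_const] at h1
      have h3 : (#{t : Fin 1 → Fin N | b t ≠ 0} : ℝ) + #{t : Fin 1 → Fin N | ¬ b t ≠ 0} =
        (N : ℝ) ^ 1 := by exact_mod_cast h1
      have : (N : ℝ) ≠ 0 := by positivity
      field_simp
      linarith
    refine ⟨b + 1, hb', by rw [hd]; linarith, by rw [← density_cobd_one hN, hb']⟩

theorem eq_zero_of_cobd_of_density_lt_one (hN : 0 < N) {c : (Fin 1 → Fin N) → ZMod 2}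
    (hc : cobd c = 0) (h : density c < 1) : c = 0 := by
  obtain ⟨t, ht⟩ : ∃ t, c t = 0 := by
    by_contra! hne
    refine h.not_ge ?_
    unfold density
    rw [filter_true_of_mem (fun t _ => hne t)]
    have : (N : ℝ) ≠ 0 := by positivity
    simp [this]
  ext s
  have := congrFun hc ![t 0, s 0]
  rw [cobd_one_apply, Pi.zero_apply, CharTwo.add_eq_zero] at this
  simp only [Matrix.cons_val_zero, Matrix.cons_val_one] at this
  rw [Pi.zero_apply, ← ht,
    ← show (fun _ => s 0) = s from funext fun i => by rw [Subsingleton.elim i 0],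
    this]
  congr 1
  exact funext fun i => by rw [Subsingleton.elim i 0]

end Density

section Filling
variable {N : ℕ} {V κ : Type*}

/-- Cochains that fill the images of small simplices, built one dimension after the other. -/
theorem exists_fillings (D : ℕ) (hN : 0 < N) (r : V → V → Prop) (B : κ → V → Prop)
    (F : ∀ P Q, (Fin P → V) → (Fin Q → Fin N) → ZMod 2) (hF0 : ∀ Q u, F 0 Q u = 0)
    (hF : ∀ P Q u, cobd (F (P + 1) Q u) = ∑ j : Fin (P + 1), F P (Q + 1) (j.removeNth u))
    (hfar : ∀ P Q u, P + Q = D + 3 → 1 ≤ P → (∃ k, ∀ a, B k (u a)) → F P Q u = 0)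
    (p η : ℝ) (hη0 : 0 ≤ η) (hp : ∀ u, density (F 1 (D + 2) u) ≤ p)
    (hη : ∀ P Q u, P + Q = D + 3 → 2 ≤ P → (∀ a b, r (u a) (u b)) → density (F P Q u) ≤ η)
    (P Q : ℕ) (hPQ : P + Q = D) :
    ∃ H : (Fin P → V) → (Fin (Q + 2) → Fin N) → ZMod 2,
      ∀ u : Fin (P + 1) → V, (∀ a b, r (u a) (u b)) →
        cobd (F (P + 1) (Q + 2) u + ∑ j : Fin (P + 1), H (j.removeNth u)) = 0 ∧
        density (F (P + 1) (Q + 2) u + ∑ j : Fin (P + 1), H (j.removeNth u)) ≤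
          (P + 1).factorial * (p + P * η) ∧
        ((∃ k, ∀ a, B k (u a)) →
          F (P + 1) (Q + 2) u + ∑ j : Fin (P + 1), H (j.removeNth u) = 0) := by
  have htwo : ∀ {n : ℕ} (a : (Fin n → Fin N) → ZMod 2), a + a = 0 := fun a =>
    funext fun t => CharTwo.add_self_eq_zero _
  induction P generalizing Q with
  | zero =>
    obtain rfl : Q = D := by omega
    refine ⟨0, fun u _ => ⟨?_, ?_, ?_⟩⟩
    · simp [hF, hF0]
    · simpa using hp u
    · intro h
      simpa using hfar 1 (Q + 2) u (by omega) le_rfl h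
  | succ P ih =>
    obtain ⟨H, hH⟩ := ih (Q + 1) (by omega)
    choose! b hb using fun u (hu : ∀ a b, r (u a) (u b)) =>
      exists_filling hN (F (P + 1) (Q + 3) u + ∑ j : Fin (P + 1), H (j.removeNth u)) (hH u hu).1
    refine ⟨b, fun u hu => ?_⟩
    have hu' : ∀ j : Fin (P + 2), ∀ a c, r (j.removeNth u a) (j.removeNth u c) :=
      fun j a c => hu _ _
    refine ⟨?_, ?_, fun hk => ?_⟩
    · rw [cobd_add, cobd_sum, hF, sum_congr rfl fun j _ => (hb _ (hu' j)).1, sum_add_distrib,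
        sum_removeNth_removeNth htwo, add_zero, htwo]
    · calc _ ≤ density (F (P + 2) (Q + 2) u) + ∑ j : Fin (P + 2), density (b (j.removeNth u)) :=
          (density_add_le _ _).trans (by gcongr; exact density_sum_le _ _)
        _ ≤ η + ∑ j : Fin (P + 2), (P + 1).factorial * (p + P * η) := by
          gcongr with j
          · exact hη _ _ u (by omega) (by omega) hu
          · exact (hb _ (hu' j)).2.trans (hH _ (hu' j)).2.1
        _ ≤ _ := by
          rw [sum_const, card_univ, Fintype.card_fin, nsmul_eq_mul, Nat.factorial_succ (P + 1)]
          have : (1 : ℝ) ≤ (P + 2) * (P + 1).factorial := by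
            norm_cast
            exact Nat.mul_pos (by omega) (Nat.factorial_pos _)
          push_cast
          nlinarith [mul_le_mul_of_nonneg_right this hη0]
    · obtain ⟨k, hk⟩ := hk
      rw [hfar _ _ u (by omega) (by omega) ⟨k, hk⟩, zero_add]
      refine sum_eq_zero fun j _ => eq_zero_of_density_nonpos hN ?_
      refine (hb _ (hu' j)).2.trans ?_
      rw [(hH _ (hu' j)).2.2 ⟨k, fun a => hk _⟩, density_zero]

theorem exists_top_filling (D : ℕ) (hN : 0 < N) (r : V → V → Prop) (B : κ → V → Prop)
    (F : ∀ P Q, (Fin P → V) → (Fin Q → Fin N) → ZMod 2) (hF0 : ∀ Q u, F 0 Q u = 0)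
    (hF : ∀ P Q u, cobd (F (P + 1) Q u) = ∑ j : Fin (P + 1), F P (Q + 1) (j.removeNth u))
    (hfar : ∀ P Q u, P + Q = D + 3 → 1 ≤ P → (∃ k, ∀ a, B k (u a)) → F P Q u = 0)
    (p η : ℝ) (hη0 : 0 ≤ η) (hp : ∀ u, density (F 1 (D + 2) u) ≤ p)
    (hη : ∀ P Q u, P + Q = D + 3 → 2 ≤ P → (∀ a b, r (u a) (u b)) → density (F P Q u) ≤ η)
    (β : ℝ) (hβ : η + (D + 2) * β < 1)
    (hnum : ∀ b : ℝ, b ≤ 1 / 2 → 2 * b * (1 - b) ≤ (D + 1).factorial * (p + D * η) → b ≤ β) :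
    ∃ H : (Fin (D + 1) → V) → (Fin 1 → Fin N) → ZMod 2,
      (∀ u : Fin (D + 2) → V, (∀ a b, r (u a) (u b)) →
        F (D + 2) 1 u = ∑ j : Fin (D + 2), H (j.removeNth u)) ∧
      (∀ u : Fin (D + 1) → V, (∀ a b, r (u a) (u b)) → (∃ k, ∀ a, B k (u a)) → H u = 0) := by
  have htwo : ∀ {n : ℕ} (a : (Fin n → Fin N) → ZMod 2), a + a = 0 := fun a =>
    funext fun t => CharTwo.add_self_eq_zero _
  obtain ⟨H, hH⟩ := exists_fillings D hN r B F hF0 hF hfar p η hη0 hp hη D 0 rfl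
  choose! b hb using fun u (hu : ∀ a b, r (u a) (u b)) =>
    exists_filling_of_two hN (F (D + 1) 2 u + ∑ j : Fin (D + 1), H (j.removeNth u)) (hH u hu).1
  have hbβ : ∀ u, (∀ a b, r (u a) (u b)) → density (b u) ≤ β := fun u hu =>
    hnum _ (hb u hu).2.1 ((hb u hu).2.2.le.trans (hH u hu).2.1)
  refine ⟨b, fun u hu => ?_, fun u hu hk => ?_⟩
  · have hu' : ∀ j : Fin (D + 2), ∀ a c, r (j.removeNth u a) (j.removeNth u c) :=
      fun j a c => hu _ _
    have hz : F (D + 2) 1 u + ∑ j : Fin (D + 2), b (j.removeNth u) = 0 := by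
      refine eq_zero_of_cobd_of_density_lt_one hN ?_ ?_
      · rw [cobd_add, cobd_sum, hF, sum_congr rfl fun j _ => (hb _ (hu' j)).1, sum_add_distrib,
          sum_removeNth_removeNth htwo, add_zero, htwo]
      · calc _ ≤ density (F (D + 2) 1 u) + ∑ j : Fin (D + 2), density (b (j.removeNth u)) :=
            (density_add_le _ _).trans (by gcongr; exact density_sum_le _ _)
          _ ≤ η + ∑ j : Fin (D + 2), β := by
            gcongr with j
            · exact hη _ _ u (by omega) (by omega) hu
            · exact hbβ _ (hu' j)
          _ < 1 := by simpa using hβ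
    exact funext fun t => CharTwo.add_eq_zero.1 (congrFun hz t)
  · have h0 := (hb u hu).2.2
    rw [(hH u hu).2.2 hk, density_zero] at h0
    refine eq_zero_of_density_nonpos hN ?_
    nlinarith [(hb u hu).2.1, density_nonneg (b u)]

end Filling

section Kuhn

/-- The vertices of the simplex of the Kuhn triangulation of the cubical grid that lies in the unit
cube with lowest vertex `q` and corresponds to the permutation `π`. -/
def kuhn {d : ℕ} (q : Fin d → ℕ) (π : Equiv.Perm (Fin d)) (n : ℕ) (j : Fin n) (i : Fin d) : ℕ :=
  q i + if (π i : ℕ) < j then 1 else 0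

theorem kuhn_le_kuhn_add_one {d : ℕ} (q : Fin d → ℕ) (π : Equiv.Perm (Fin d)) (n : ℕ)
    (a b : Fin n) (i : Fin d) : kuhn q π n a i ≤ kuhn q π n b i + 1 := by
  unfold kuhn
  split_ifs <;> omega

/-- The cubes of the grid with `K` cubes in each direction. -/
def grid (d K : ℕ) : Finset (Fin d → ℕ) := Fintype.piFinset fun _ => range K

theorem sum_range_add_succ (K : ℕ) (g : ℕ → ZMod 2) :
    ∑ m ∈ range K, (g m + g (m + 1)) = g 0 + g K := by
  induction K with
  | zero => simp [CharTwo.add_self_eq_zero]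
  | succ K ih =>
    rw [sum_range_succ, ih]
    linear_combination CharTwo.add_self_eq_zero (g K)

theorem sum_kuhn_prod (d K : ℕ) (g : Fin d → ℕ → ZMod 2) (h0 : ∀ k, g k 0 = 1)
    (hK : ∀ k, g k K = 0) :
    ∑ q ∈ grid d K, ∑ π : Equiv.Perm (Fin d), ∏ k : Fin d,
      (g k (kuhn q π (d + 1) k.castSucc k) + g k (kuhn q π (d + 1) k.succ k)) = 1 := by
  have hπ : ∀ q : Fin d → ℕ, ∑ π : Equiv.Perm (Fin d), ∏ k : Fin d,
      (g k (kuhn q π (d + 1) k.castSucc k) + g k (kuhn q π (d + 1) k.succ k)) =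
      ∏ k : Fin d, (g k (q k) + g k (q k + 1)) := fun q => by
    rw [sum_eq_single (1 : Equiv.Perm (Fin d)) (fun π _ hπ => ?_) (by simp)]
    · simp [kuhn]
    · obtain ⟨k, hk⟩ : ∃ k, π k ≠ k := by
        by_contra! h
        exact hπ (Equiv.ext h)
      refine prod_eq_zero (mem_univ k) ?_
      have : kuhn q π (d + 1) k.castSucc k = kuhn q π (d + 1) k.succ k := by
        have : (π k : ℕ) ≠ k := fun h => hk (Fin.ext h)
        simp only [kuhn, Fin.val_castSucc, Fin.val_succ]
        split_ifs <;> omega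
      rw [this, CharTwo.add_self_eq_zero]
  rw [sum_congr rfl fun q _ => hπ q, grid, ← prod_univ_sum (fun _ => range K)
    (fun k m => g k m + g k (m + 1))]
  exact prod_eq_one fun k _ => by rw [sum_range_add_succ, h0, hK, add_zero]

theorem sum_grid_add_single {A : Type*} [AddCommMonoid A] {d K : ℕ} (a : Fin d)
    (g : (Fin d → ℕ) → A) (h0 : ∀ q, q a = 0 → g q = 0) (hK : ∀ q, q a = K → g q = 0) :
    ∑ q ∈ grid d K, g (q + Pi.single a 1) = ∑ q ∈ grid d K, g q := by
  refine sum_bij_ne_zero (fun q _ _ => q + Pi.single a 1) (fun q hq hg => ?_)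
    (fun q _ _ q' _ _ h => add_right_cancel h) (fun q hq hg => ?_) (fun _ _ _ => rfl)
  · simp only [grid, Fintype.mem_piFinset, mem_range] at hq ⊢
    intro i
    rcases eq_or_ne i a with rfl | hi
    · have := hq i
      have : (q + Pi.single i 1 : Fin d → ℕ) i ≠ K := fun h => hg (hK _ h)
      simp only [Pi.add_apply, Pi.single_eq_same] at this ⊢
      omega
    · simpa [hi] using hq i
  · have h1 : q a ≠ 0 := fun h => hg (h0 _ h)
    have h2 : (q - Pi.single a 1) + Pi.single a 1 = q := by
      ext i
      rcases eq_or_ne i a with rfl | hi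
      · simp; omega
      · simp [hi]
    refine ⟨q - Pi.single a 1, ?_, by rwa [h2], h2⟩
    simp only [grid, Fintype.mem_piFinset, mem_range] at hq ⊢
    exact fun i => (Nat.sub_le _ _).trans_lt (hq i)

theorem sum_kuhn_removeNth_mid {A : Type*} [AddCommGroup A] (hA : ∀ a : A, a + a = 0) {D : ℕ}
    (H : (Fin (D + 1) → Fin (D + 1) → ℕ) → A) (q : Fin (D + 1) → ℕ) (j : Fin D) :
    ∑ π : Equiv.Perm (Fin (D + 1)), H (j.castSucc.succ.removeNth (kuhn q π (D + 2))) = 0 := by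
  have hne : j.castSucc ≠ j.succ := by simp [Fin.ext_iff]
  have hinv : ∀ π : Equiv.Perm (Fin (D + 1)),
      j.castSucc.succ.removeNth (kuhn q (Equiv.swap j.castSucc j.succ * π) (D + 2)) =
      j.castSucc.succ.removeNth (kuhn q π (D + 2)) := fun π => by
    ext a i
    have ha : (j.castSucc.succ.succAbove a : ℕ) ≠ j + 1 := fun h =>
      Fin.succAbove_ne j.castSucc.succ a (Fin.ext (by simpa using h))
    simp only [Fin.removeNth, kuhn, Equiv.Perm.mul_apply, Equiv.swap_apply_def]
    congr 1
    split_ifs <;> simp_all [Fin.ext_iff] <;> omega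
  refine sum_involution (fun π _ => Equiv.swap j.castSucc j.succ * π) (fun π _ => ?_)
    (fun π _ _ h => ?_) (fun _ _ => mem_univ _) (fun π _ => ?_)
  · rw [hinv, hA]
  · rw [mul_eq_right, Equiv.swap_eq_one_iff] at h
    exact hne h
  · rw [← mul_assoc, Equiv.swap_mul_self, one_mul]

theorem removeNth_last_kuhn {D : ℕ} (q : Fin (D + 1) → ℕ) (π : Equiv.Perm (Fin (D + 1))) :
    (Fin.last (D + 1)).removeNth (kuhn q π (D + 2)) = kuhn q π (D + 1) := by
  ext a i
  simp [Fin.removeNth, kuhn]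

theorem removeNth_zero_kuhn {D : ℕ} (q : Fin (D + 1) → ℕ) (π : Equiv.Perm (Fin (D + 1))) :
    (0 : Fin (D + 2)).removeNth (kuhn q (finRotate (D + 1) * π) (D + 2)) =
      kuhn (q + Pi.single (π⁻¹ (Fin.last D)) 1) π (D + 1) := by
  ext a i
  have ha := a.2
  rcases eq_or_ne (π i) (Fin.last D) with hi | hi
  · obtain rfl : i = π⁻¹ (Fin.last D) := by rw [← hi]; simp
    simp [Fin.removeNth, kuhn]
    omega
  · have hi' : i ≠ π⁻¹ (Fin.last D) := fun h => hi (by simp [h])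
    have : ((finRotate (D + 1) (π i) : Fin (D + 1)) : ℕ) = π i + 1 := coe_finRotate_of_ne_last hi
    simp only [Fin.removeNth, kuhn, Equiv.Perm.mul_apply, this, Pi.add_apply,
      Pi.single_eq_of_ne hi', add_zero, Fin.zero_succAbove, Fin.val_succ, add_lt_add_iff_right]

/-- The Kuhn triangulation of a cube is a relative cycle modulo 2. -/
theorem sum_kuhn_removeNth {A : Type*} [AddCommGroup A] (hA : ∀ a : A, a + a = 0) {D K : ℕ}
    (H : (Fin (D + 1) → Fin (D + 1) → ℕ) → A)
    (h0 : ∀ q π, (∃ i, ∀ a, kuhn q π (D + 1) a i = 0) → H (kuhn q π (D + 1)) = 0)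
    (hK : ∀ q π, (∃ i, ∀ a, kuhn q π (D + 1) a i = K) → H (kuhn q π (D + 1)) = 0) :
    ∑ q ∈ grid (D + 1) K, ∑ π : Equiv.Perm (Fin (D + 1)), ∑ j : Fin (D + 2),
      H (j.removeNth (kuhn q π (D + 2))) = 0 := by
  have hlast : ∀ (q : Fin (D + 1) → ℕ) (π : Equiv.Perm (Fin (D + 1))) (a : Fin (D + 1)),
      kuhn q π (D + 1) a (π⁻¹ (Fin.last D)) = q (π⁻¹ (Fin.last D)) := fun q π a => by
    have := a.2
    simp [kuhn]
    omega
  have hmain : ∑ q ∈ grid (D + 1) K, ∑ π : Equiv.Perm (Fin (D + 1)),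
      H ((0 : Fin (D + 2)).removeNth (kuhn q π (D + 2))) =
      ∑ q ∈ grid (D + 1) K, ∑ π : Equiv.Perm (Fin (D + 1)),
      H ((Fin.last (D + 1)).removeNth (kuhn q π (D + 2))) := by
    rw [sum_comm, sum_comm (s := grid (D + 1) K),
      ← Equiv.sum_comp (Equiv.mulLeft (finRotate (D + 1)))]
    refine sum_congr rfl fun π _ => ?_
    simp only [Equiv.coe_mulLeft, removeNth_zero_kuhn, removeNth_last_kuhn]
    exact sum_grid_add_single (π⁻¹ (Fin.last D)) (fun q => H (kuhn q π (D + 1)))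
      (fun q hq => h0 q π ⟨_, fun a => (hlast q π a).trans hq⟩)
      (fun q hq => hK q π ⟨_, fun a => (hlast q π a).trans hq⟩)
  have hsplit : ∀ q ∈ grid (D + 1) K, ∑ π : Equiv.Perm (Fin (D + 1)), ∑ j : Fin (D + 2),
      H (j.removeNth (kuhn q π (D + 2))) =
      ∑ π : Equiv.Perm (Fin (D + 1)), H ((0 : Fin (D + 2)).removeNth (kuhn q π (D + 2))) +
      ∑ π : Equiv.Perm (Fin (D + 1)), H ((Fin.last (D + 1)).removeNth (kuhn q π (D + 2))) := by
    intro q _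
    simp only [Fin.sum_univ_succ (n := D + 1), Fin.sum_univ_castSucc (n := D), sum_add_distrib]
    rw [sum_comm (t := (univ : Finset (Fin D))),
      sum_eq_zero fun j _ => sum_kuhn_removeNth_mid hA H q j, zero_add]
    rfl
  rw [sum_congr rfl hsplit, sum_add_distrib, hmain, hA]

end Kuhn

section GridCochain

variable {D N : ℕ}

/-- The indicator modulo 2 of the `i`-th coordinate of the grid point `s u - R` being at most the
`i`-th coordinate of `f x`. -/
noncomputable def gridTest {X : Type*} {d : ℕ} (f : X → Fin d → ℝ) (s R : ℝ) (i : ℕ)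
    (u : Fin d → ℕ) (x : X) : ZMod 2 :=
  if h : i < d then if s * u ⟨i, h⟩ - R ≤ f x ⟨i, h⟩ then 1 else 0 else 0

/-- The cochain on the vertices of the standard simplex that counts modulo 2 the intersections of
the `m`-fold subdivided image of a face with the simplex of the grid spanned by `u`. -/
noncomputable def gridCochain {d : ℕ} (f : (Fin N → ℝ) → Fin d → ℝ) (s R : ℝ) (m P Q : ℕ)
    (u : Fin P → Fin d → ℕ) (t : Fin Q → Fin N) : ZMod 2 :=
  (subdiv Q)^[m] (pairing (gridTest f s R) 0 P Q u) fun i => Pi.single (t i) 1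

/-- The image under `f` of the face with vertices `t` comes within distance `ρ` of `c`. -/
def NearFace {d : ℕ} (f : (Fin N → ℝ) → Fin d → ℝ) (ρ : ℝ) (c : Fin d → ℝ) {Q : ℕ}
    (t : Fin Q → Fin N) : Prop :=
  ∃ x ∈ convexHull ℝ (Set.range fun i => (Pi.single (t i) 1 : Fin N → ℝ)), dist c (f x) ≤ ρ

theorem convexHull_single_subset_stdSimplex {Q : ℕ} (t : Fin Q → Fin N) :
    convexHull ℝ (Set.range fun i => (Pi.single (t i) 1 : Fin N → ℝ)) ⊆ stdSimplex ℝ (Fin N) :=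
  convexHull_min (by rintro _ ⟨i, rfl⟩; exact single_mem_stdSimplex ℝ (t i))
    (convex_stdSimplex ℝ (Fin N))

theorem cobd_gridCochain {d : ℕ} (f : (Fin N → ℝ) → Fin d → ℝ) (s R : ℝ) (m P Q : ℕ)
    (u : Fin (P + 1) → Fin d → ℕ) :
    cobd (gridCochain f s R m (P + 1) Q u) =
      ∑ j : Fin (P + 1), gridCochain f s R m P (Q + 1) (j.removeNth u) := by
  have h1 : cobd (pairing (gridTest f s R) 0 (P + 1) Q u) =
      ∑ j : Fin (P + 1), pairing (gridTest f s R) 0 P (Q + 1) (j.removeNth u) := by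
    ext x
    rw [Finset.sum_apply, cobd]
    exact (CharTwo.add_eq_zero.1 (sum_pairing_add_sum_pairing (gridTest f s R) 0 P Q u x)).symm
  ext t
  have h2 := congrFun (cobd_iterate_subdiv m (pairing (gridTest f s R) 0 (P + 1) Q u))
    fun i => Pi.single (t i) 1
  rw [h1, iterate_subdiv_sum, Finset.sum_apply] at h2
  rw [Finset.sum_apply]
  exact h2.symm

theorem gridCochain_zero_left {d : ℕ} (f : (Fin N → ℝ) → Fin d → ℝ) (s R : ℝ) (m Q : ℕ)
    (u : Fin 0 → Fin d → ℕ) : gridCochain f s R m 0 Q u = 0 := by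
  have h : pairing (gridTest f s R) 0 0 Q u = 0 := funext fun x => pairing_zero_left _ _ _ _ _
  ext t
  rw [gridCochain, h, Function.iterate_fixed (subdiv_zero Q)]
  rfl

theorem exists_of_gridCochain_ne_zero {d M : ℕ} {f : (Fin N → ℝ) → Fin d → ℝ} {s R δ : ℝ}
    {m P Q : ℕ} (hQ : Q ≤ M) (hM : 1 ≤ M)
    (hf : ∀ x ∈ stdSimplex ℝ (Fin N), ∀ y ∈ stdSimplex ℝ (Fin N), dist x y ≤ δ →
      dist (f x) (f y) ≤ s) (hm : (1 - 1 / (M : ℝ)) ^ m ≤ δ)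
    {u : Fin P → Fin d → ℕ} {t : Fin Q → Fin N} (h : gridCochain f s R m P Q u t ≠ 0) :
    ∃ x : Fin Q → Fin N → ℝ, pairing (gridTest f s R) 0 P Q u x ≠ 0 ∧
      (∀ i, x i ∈ convexHull ℝ (Set.range fun i => (Pi.single (t i) 1 : Fin N → ℝ))) ∧
      ∀ i j, dist (f (x i)) (f (x j)) ≤ s := by
  obtain ⟨x, hx, hc, hd⟩ := exists_of_iterate_subdiv_ne_zero M Q hQ hM m _ _ zero_le_one
    (fun i j => (dist_pi_le_iff zero_le_one).2 fun k => by
      rw [Pi.single_apply, Pi.single_apply]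
      split_ifs <;> simp) h
  exact ⟨x, hx, hc, fun i j => hf _ (convexHull_single_subset_stdSimplex t (hc i)) _
    (convexHull_single_subset_stdSimplex t (hc j)) ((hd i j).trans (by rwa [mul_one]))⟩

theorem nearFace_of_gridCochain_ne_zero {M : ℕ} {f : (Fin N → ℝ) → Fin (D + 1) → ℝ} {s R δ : ℝ}
    (hs : 0 < s) {m P Q : ℕ} (hQ : Q ≤ M) (hM : 1 ≤ M)
    (hf : ∀ x ∈ stdSimplex ℝ (Fin N), ∀ y ∈ stdSimplex ℝ (Fin N), dist x y ≤ δ →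
      dist (f x) (f y) ≤ s) (hm : (1 - 1 / (M : ℝ)) ^ m ≤ δ) (hPQ : P + Q = D + 3)
    {u : Fin P → Fin (D + 1) → ℕ} (hu : ∀ a b i, u a i ≤ u b i + 1) {t : Fin Q → Fin N}
    (h : gridCochain f s R m P Q u t ≠ 0) (a₀ : Fin P) :
    NearFace f (2 * s) (fun i => s * u a₀ i - R) t := by
  obtain ⟨x, hx, hc, hd⟩ := exists_of_gridCochain_ne_zero hQ hM hf hm h
  have hQ0 : Q ≠ 0 := by
    rintro rfl
    simp at hx
  let b₀ : Fin Q := ⟨0, by omega⟩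
  refine ⟨x b₀, hc b₀, (dist_pi_le_iff (by positivity)).2 fun k => ?_⟩
  have hk : ¬ ∀ a b a' b', gridTest f s R k (u a) (x b) = gridTest f s R k (u a') (x b') :=
    fun hk => hx (pairing_eq_zero_of_const _ 0 P Q k (Nat.zero_le _) (by omega) u x hk)
  have hu' : ∀ a b, s * (u a k : ℝ) ≤ s * u b k + s := fun a b => by
    have : (u a k : ℝ) ≤ u b k + 1 := by exact_mod_cast hu a b k
    nlinarith
  have hd' : ∀ i j, |f (x i) k - f (x j) k| ≤ s := fun i j =>
    (dist_le_pi_dist (f (x i)) (f (x j)) k).trans (hd i j)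
  have hlow : ∃ a b, s * u a k - R ≤ f (x b) k := by
    by_contra! hcon
    exact hk fun a b a' b' => by simp [gridTest, (hcon a b).not_ge, (hcon a' b').not_ge]
  have hhigh : ∃ a b, f (x b) k < s * u a k - R := by
    by_contra! hcon
    exact hk fun a b a' b' => by simp [gridTest, hcon a b, hcon a' b']
  obtain ⟨a, b, hab⟩ := hlow
  obtain ⟨a', b', hab'⟩ := hhigh
  have h1 := abs_le.1 (hd' b b₀)
  have h2 := abs_le.1 (hd' b' b₀)
  have h3 := hu' a₀ a
  have h4 := hu' a' a₀
  rw [Real.dist_eq, abs_le]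
  constructor <;> linarith

theorem gridCochain_eq_zero_of_far {M : ℕ} {f : (Fin N → ℝ) → Fin (D + 1) → ℝ} {s R δ : ℝ}
    {m P Q : ℕ} (hQ : Q ≤ M) (hM : 1 ≤ M)
    (hf : ∀ x ∈ stdSimplex ℝ (Fin N), ∀ y ∈ stdSimplex ℝ (Fin N), dist x y ≤ δ →
      dist (f x) (f y) ≤ s) (hm : (1 - 1 / (M : ℝ)) ^ m ≤ δ) (hPQ : P + Q = D + 3)
    {u : Fin P → Fin (D + 1) → ℕ} (k : Fin (D + 1)) (v : ZMod 2)
    (hk : ∀ a, ∀ x ∈ stdSimplex ℝ (Fin N), gridTest f s R k (u a) x = v) :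
    gridCochain f s R m P Q u = 0 := by
  ext t
  by_contra h
  obtain ⟨x, hx, hc, -⟩ := exists_of_gridCochain_ne_zero hQ hM hf hm h
  exact hx (pairing_eq_zero_of_const _ 0 P Q k (Nat.zero_le _) (by omega) u x fun a b a' b' => by
    rw [hk a _ (convexHull_single_subset_stdSimplex t (hc b)),
      hk a' _ (convexHull_single_subset_stdSimplex t (hc b'))])

theorem gridCochain_one_right {d : ℕ} (f : (Fin N → ℝ) → Fin d → ℝ) (s R : ℝ) (m P : ℕ)
    (u : Fin P → Fin d → ℕ) (t : Fin 1 → Fin N) : gridCochain f s R m P 1 u t =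
      pairing (gridTest f s R) 0 P 1 u fun i => Pi.single (t i) 1 := by
  rw [gridCochain, Function.iterate_fixed (subdiv_one _)]

open Classical in
/-- If few faces of dimension less than `D + 1` come near any given point, then many faces of
dimension `D + 1` come near some point. -/
theorem exists_card_nearFace_gt (hN : 0 < N) {f : (Fin N → ℝ) → Fin (D + 1) → ℝ}
    (hf : ContinuousOn f (stdSimplex ℝ (Fin N))) {s : ℝ} (hs : 0 < s) {p η β : ℝ} (hη0 : 0 ≤ η)
    (hβ : η + (D + 2) * β < 1)
    (hnum : ∀ b : ℝ, b ≤ 1 / 2 → 2 * b * (1 - b) ≤ (D + 1).factorial * (p + D * η) → b ≤ β)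
    (hη : ∀ c Q, Q ≤ D + 1 →
      (#{t : Fin Q → Fin N | NearFace f (2 * s) c t} : ℝ) ≤ η * (N : ℝ) ^ Q) :
    ∃ c, p * (N : ℝ) ^ (D + 2) < #{t : Fin (D + 2) → Fin N | NearFace f (2 * s) c t} := by
  by_contra! hp
  have hcpt := isCompact_stdSimplex ℝ (Fin N)
  obtain ⟨δ, hδ, hfδ⟩ : ∃ δ > 0, ∀ x ∈ stdSimplex ℝ (Fin N), ∀ y ∈ stdSimplex ℝ (Fin N),
      dist x y ≤ δ → dist (f x) (f y) ≤ s := by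
    obtain ⟨δ, hδ, h⟩ := Metric.uniformContinuousOn_iff.1
      (hcpt.uniformContinuousOn_of_continuous hf) s hs
    exact ⟨δ / 2, by positivity, fun x hx y hy hxy => (h x hx y hy (by linarith)).le⟩
  obtain ⟨R, hR⟩ : ∃ R : ℝ, ∀ x ∈ stdSimplex ℝ (Fin N), ∀ k, |f x k| < R := by
    obtain ⟨R, hR⟩ := (hcpt.image_of_continuousOn hf).isBounded.exists_norm_le
    exact ⟨R + 1, fun x hx k => ((norm_le_pi_norm (f x) k).trans (hR _ ⟨x, hx, rfl⟩)).trans_lt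
      (lt_add_one R)⟩
  obtain ⟨K, hK⟩ := exists_nat_ge (2 * R / s)
  rw [div_le_iff₀ hs] at hK
  obtain ⟨m, hm⟩ : ∃ m : ℕ, (1 - 1 / ((D + 3 : ℕ) : ℝ)) ^ m ≤ δ := by
    have h1 : 0 < 1 / ((D + 3 : ℕ) : ℝ) := by positivity
    have h2 : 1 / ((D + 3 : ℕ) : ℝ) ≤ 1 := by
      rw [div_le_one (by positivity)]
      exact_mod_cast Nat.le_add_left 1 (D + 2)
    obtain ⟨m, hm⟩ := exists_pow_lt_of_lt_one hδ (show 1 - 1 / ((D + 3 : ℕ) : ℝ) < 1 by linarith)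
    exact ⟨m, hm.le⟩
  have h0 : ∀ (u : Fin (D + 1) → ℕ) (k : Fin (D + 1)), u k = 0 → ∀ x ∈ stdSimplex ℝ (Fin N),
      gridTest f s R k u x = 1 := fun u k hu x hx => by
    have := (abs_lt.1 (hR x hx k)).1
    have h : -R ≤ f x k := by linarith
    simp [gridTest, hu, h, Fin.is_le k]
  have hK' : ∀ (u : Fin (D + 1) → ℕ) (k : Fin (D + 1)), u k = K → ∀ x ∈ stdSimplex ℝ (Fin N),
      gridTest f s R k u x = 0 := fun u k hu x hx => by
    have := (abs_lt.1 (hR x hx k)).2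
    have h : f x k < s * K - R := by linarith
    simp [gridTest, hu, h.not_ge]
  have hdens : ∀ P Q (u : Fin P → Fin (D + 1) → ℕ) (e : ℝ) (a₀ : Fin P), P + Q = D + 3 →
      (∀ a b i, u a i ≤ u b i + 1) →
      (#{t : Fin Q → Fin N | NearFace f (2 * s) (fun i => s * u a₀ i - R) t} : ℝ) ≤
        e * (N : ℝ) ^ Q → density (gridCochain f s R m P Q u) ≤ e := by
    intro P Q u e a₀ hPQ hu he
    rw [density, div_le_iff₀ (by positivity)]
    refine le_trans ?_ he
    gcongr with t _
    intro ht
    exact nearFace_of_gridCochain_ne_zero hs (by omega) (by omega) hfδ hm hPQ hu ht a₀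
  obtain ⟨H, hH, hHfar⟩ := exists_top_filling D hN
    (fun u v : Fin (D + 1) → ℕ => ∀ i, u i ≤ v i + 1)
    (fun (k : Fin (D + 1) × ZMod 2) v => ∀ x ∈ stdSimplex ℝ (Fin N), gridTest f s R k.1 v x = k.2)
    (gridCochain f s R m) (gridCochain_zero_left f s R m) (cobd_gridCochain f s R m)
    (fun P Q u hPQ hP ⟨k, hk⟩ =>
      gridCochain_eq_zero_of_far (by omega) (by omega) hfδ hm hPQ k.1 k.2 hk) p η hη0
    (fun u => hdens 1 (D + 2) u p 0 (by omega) (fun a b i => by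
      rw [Subsingleton.elim a b]; omega) (hp _))
    (fun P Q u hPQ hP hu => hdens P Q u η ⟨0, by omega⟩ hPQ hu (hη _ Q (by omega))) β hβ hnum
  have hzero : ∑ q ∈ grid (D + 1) K, ∑ π : Equiv.Perm (Fin (D + 1)),
      gridCochain f s R m (D + 2) 1 (kuhn q π (D + 2)) = 0 := by
    rw [← sum_kuhn_removeNth (fun a => funext fun t => CharTwo.add_self_eq_zero _) (K := K) H
      (fun q π ⟨k, hk⟩ => hHfar _ (kuhn_le_kuhn_add_one q π _) ⟨(k, 1), fun a => h0 _ k (hk a)⟩)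
      (fun q π ⟨k, hk⟩ => hHfar _ (kuhn_le_kuhn_add_one q π _) ⟨(k, 0), fun a => hK' _ k (hk a)⟩)]
    exact sum_congr rfl fun q _ => sum_congr rfl fun π _ => hH _ (kuhn_le_kuhn_add_one q π _)
  let x : Fin N → ℝ := Pi.single ⟨0, hN⟩ 1
  have hx : x ∈ stdSimplex ℝ (Fin N) := single_mem_stdSimplex ℝ _
  have hone := sum_kuhn_prod (D + 1) K (fun k a => gridTest f s R k (fun _ => a) x)
    (fun k => h0 _ k rfl x hx) (fun k => hK' _ k rfl x hx)
  have := congrFun hzero fun _ => ⟨0, hN⟩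
  simp only [Finset.sum_apply, gridCochain_one_right, pairing_one_right, Pi.zero_apply, zero_add]
    at this
  refine zero_ne_one (this.symm.trans (Eq.trans ?_ hone))
  refine sum_congr rfl fun q _ => sum_congr rfl fun π _ => prod_congr rfl fun k _ => ?_
  simp [gridTest, x]

end GridCochain

section Compactness
open Filter Topology

/-- Finitely many compact sets without a common point do not all come close to any point. -/
theorem eventually_forall_exists_lt_dist {ι E : Type*} [Finite ι] [MetricSpace E]
    {A : ι → Set E} (hA : ∀ i, IsCompact (A i)) (hne : ¬ ∃ c, ∀ i, c ∈ A i) :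
    ∀ᶠ r : ℝ in 𝓝[>] 0, ∀ c, ∃ i, ∀ y ∈ A i, r < dist c y := by
  have := Fintype.ofFinite ι
  rcases isEmpty_or_nonempty ι with hι | ⟨⟨i₀⟩⟩
  · exact Eventually.of_forall fun r c => (hne ⟨c, fun i => isEmptyElim i⟩).elim
  rcases (Set.univ.pi A).eq_empty_or_nonempty with he | hne'
  · obtain ⟨i, hi⟩ := Set.univ_pi_eq_empty_iff.1 he
    exact Eventually.of_forall fun r c => ⟨i, by simp [hi]⟩
  obtain ⟨y, hy, hmin⟩ := (isCompact_univ_pi hA).exists_isMinOn hne'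
    (f := fun y : ι → E => ∑ i, dist (y i) (y i₀)) (by fun_prop)
  have hpos : 0 < ∑ i, dist (y i) (y i₀) := by
    refine (sum_nonneg fun i _ => dist_nonneg).lt_of_ne fun h => hne ⟨y i₀, fun i => ?_⟩
    have := (sum_eq_zero_iff_of_nonneg fun i _ => dist_nonneg).1 h.symm i (mem_univ i)
    rw [← dist_eq_zero.1 this]
    exact hy i trivial
  have hlim : ∀ᶠ r : ℝ in 𝓝[>] 0, Fintype.card ι * (2 * r) < ∑ i, dist (y i) (y i₀) := by
    refine nhdsWithin_le_nhds (ContinuousAt.eventually_lt (by fun_prop) continuousAt_const ?_)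
    simpa using hpos
  filter_upwards [hlim] with r hr c
  by_contra! h
  choose z hz hzr using h
  refine absurd (hmin (show z ∈ Set.univ.pi A from fun i _ => hz i))
    (not_le.2 (lt_of_le_of_lt ?_ hr))
  calc ∑ i, dist (z i) (z i₀) ≤ ∑ _i : ι, 2 * r := sum_le_sum fun i _ => by
        linarith [dist_triangle_left (z i) (z i₀) c, hzr i, hzr i₀]
    _ = _ := by simp

end Compactness

section GeneralPosition

variable {N d : ℕ}

theorem dimH_concurrent_le {g : (Fin N → ℝ) → Fin d → ℝ} (hg : ContDiff ℝ 1 g)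
    {A : Fin (d + 1) → Finset (Fin N)} (hA : ∀ i, #(A i) ≤ d)
    (hdisj : Pairwise (Function.onFun Disjoint A)) {v : Fin (d + 1) → Fin N}
    (hv : ∀ i, v i ∈ A i) :
    dimH {w : Fin N → Fin d → ℝ | ∃ (c : Fin d → ℝ) (x : Fin (d + 1) → Fin N → ℝ),
      ∀ i, (∀ n ∉ A i, x i n = 0) ∧ ∑ n, x i n = 1 ∧ 0 < x i (v i) ∧
        g (x i) + ∑ n, x i n • w n = c} ≤ ((N * d - 1 : ℕ) : ENNReal) := by
  classical
  have hAeq : ∀ {i j n}, n ∈ A i → n ∈ A j → i = j := fun {i j n} hi hj => by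
    by_contra hij
    exact disjoint_left.1 (hdisj hij) hi hj
  have hvinj : Function.Injective v := fun i j h => hAeq (hv i) (h ▸ hv j)
  let V : Finset (Fin N) := univ.image v
  let J : Finset (Fin N) := univ.biUnion A \ V
  let E := (Fin d → ℝ) × (J → ℝ) × ((Vᶜ : Finset (Fin N)) → Fin d → ℝ)
  let Z : E → Fin N → ℝ := fun p n => if h : n ∈ J then p.2.1 ⟨n, h⟩ else 0
  let W : E → Fin N → Fin d → ℝ := fun p n => if h : n ∈ Vᶜ then p.2.2 ⟨n, h⟩ else 0
  let y : E → Fin (d + 1) → Fin N → ℝ := fun p i =>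
    Pi.single (v i) 1 + ∑ j ∈ A i, Z p j • (Pi.single j 1 - Pi.single (v i) 1)
  let a : E → Fin (d + 1) → ℝ := fun p i => 1 - ∑ j ∈ A i, Z p j
  let Φ : E → Fin N → Fin d → ℝ := fun p n =>
    if h : ∃ i, v i = n then
      (a p h.choose)⁻¹ • (p.1 - g (y p h.choose) - ∑ j ∈ A h.choose, Z p j • W p j)
    else W p n
  have hΦv : ∀ p i, Φ p (v i) =
      (a p i)⁻¹ • (p.1 - g (y p i) - ∑ j ∈ A i, Z p j • W p j) := fun p i => by
    have h : ∃ i', v i' = v i := ⟨i, rfl⟩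
    have h' : h.choose = i := hvinj h.choose_spec
    simp only [Φ, dif_pos h, h']
  let s : Set E := {p | ∀ i, 0 < a p i}
  have hZsmooth : ∀ n, ContDiff ℝ 1 fun p => Z p n := fun n => by
    by_cases h : n ∈ J
    · simp only [Z, dif_pos h]; fun_prop
    · simp only [Z, dif_neg h]; fun_prop
  have hWsmooth : ∀ n, ContDiff ℝ 1 fun p => W p n := fun n => by
    by_cases h : n ∈ Vᶜ
    · simp only [W, dif_pos h]; fun_prop
    · simp only [W, dif_neg h]; fun_prop
  have hZadd : ∀ p q n, Z (p + q) n = Z p n + Z q n := fun p q n => by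
    by_cases h : n ∈ J
    · simp only [Z, dif_pos h]; rfl
    · simp only [Z, dif_neg h, add_zero]
  have hZsmul : ∀ (r : ℝ) p n, Z (r • p) n = r * Z p n := fun r p n => by
    by_cases h : n ∈ J
    · simp only [Z, dif_pos h]; rfl
    · simp only [Z, dif_neg h, mul_zero]
  have hs : Convex ℝ s := by
    intro p hp q hq α β hα hβ hαβ i
    have : a (α • p + β • q) i = α * a p i + β * a q i := by
      simp only [a, hZadd, hZsmul, sum_add_distrib, ← mul_sum]
      linear_combination (1 : ℝ) * (-hαβ)
    rw [this]
    rcases hα.eq_or_lt with rfl | hα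
    · obtain rfl : β = 1 := by linarith
      simpa using hq i
    · have := mul_pos hα (hp i)
      have := mul_nonneg hβ (hq i).le
      linarith
  have hΦ : ContDiffOn ℝ 1 Φ s := by
    refine contDiffOn_pi.2 fun n => ?_
    by_cases h : ∃ i, v i = n
    · obtain ⟨i, rfl⟩ := h
      simp only [hΦv]
      have ha : ContDiff ℝ 1 fun p => a p i := by
        simp only [a]; fun_prop
      have hy : ContDiff ℝ 1 fun p => y p i := by
        simp only [y]; fun_prop
      refine ContDiffOn.smul (ha.contDiffOn.inv fun p hp => (hp i).ne') (ContDiff.contDiffOn ?_)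
      have := hg.comp hy
      fun_prop
    · simp only [Φ, dif_neg h]
      exact (hWsmooth n).contDiffOn
  have hdim : dimH (Φ '' s) ≤ ((N * d - 1 : ℕ) : ENNReal) := by
    refine (hΦ.dimH_image_le hs subset_rfl).trans ((dimH_mono (Set.subset_univ s)).trans ?_)
    rw [Real.dimH_univ_eq_finrank]
    have hV : #V = d + 1 := by simp [V, card_image_of_injective _ hvinj]
    have hVN : d + 1 ≤ N := by simpa [hV] using card_le_univ V
    have hVA : V ⊆ univ.biUnion A := fun n hn => by
      obtain ⟨i, -, rfl⟩ := mem_image.1 hn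
      exact mem_biUnion.2 ⟨i, mem_univ i, hv i⟩
    have hJ : #J + (d + 1) ≤ (d + 1) * d := by
      have h1 : #J + #V = #(univ.biUnion A) := card_sdiff_add_card_eq_card hVA
      have h2 : #(univ.biUnion A) ≤ (d + 1) * d := by
        simpa using card_biUnion_le_card_mul univ A d fun i _ => hA i
      omega
    have hC : #Vᶜ + (d + 1) = N := by
      have := card_compl_add_card V
      simpa [hV] using this
    have : Module.finrank ℝ E = d + (#J + #Vᶜ * d) := by simp [E, Module.finrank_pi_fintype]
    rw [this]
    have : d + (#J + #Vᶜ * d) + 1 ≤ N * d := by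
      conv_rhs => rw [← hC]
      nlinarith
    exact_mod_cast Nat.le_sub_one_of_lt this
  refine (dimH_mono ?_).trans hdim
  rintro w ⟨c, x, hx⟩
  let p : E := (c, fun j => ∑ i, x i j, fun n => w n)
  have hZp : ∀ i, ∀ j ∈ A i, Z p j = if j = v i then 0 else x i j := fun i j hj => by
    have hjV : j ∈ V ↔ j = v i := by
      simp only [V, mem_image, mem_univ, true_and]
      refine ⟨fun ⟨i', hi'⟩ => ?_, fun h => ⟨i, h.symm⟩⟩
      rw [← hi', hAeq (hv i') (hi' ▸ hj)]
    have hjJ : j ∈ J ↔ j ≠ v i := by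
      simp only [J, mem_sdiff, mem_biUnion, mem_univ, true_and, hjV, and_iff_right_iff_imp]
      exact fun _ => ⟨i, hj⟩
    by_cases h : j = v i
    · simp only [Z, dif_neg (mt hjJ.1 (not_not.2 h)), if_pos h]
    · simp only [Z, dif_pos (hjJ.2 h), if_neg h, p]
      exact sum_eq_single i (fun i' _ hi' => (hx i').1 j fun hj' => hi' (hAeq hj' hj)) (by simp)
  have hZsum : ∀ {M : Type} [AddCommGroup M] [Module ℝ M] (i) (b : Fin N → M),
      ∑ j ∈ A i, Z p j • b j = ∑ n, x i n • b n - x i (v i) • b (v i) := fun {M} _ _ i b => by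
    rw [← sum_subset (subset_univ (A i)) fun n _ hn => by rw [(hx i).1 n hn, zero_smul],
      ← add_sum_erase _ _ (hv i), ← add_sum_erase _ _ (hv i), hZp i _ (hv i), if_pos rfl, zero_smul,
      zero_add, add_sub_cancel_left]
    exact sum_congr rfl fun j hj => by
      rw [hZp i j (mem_of_mem_erase hj), if_neg (ne_of_mem_erase hj)]
  have hap : ∀ i, a p i = x i (v i) := fun i => by
    have := hZsum i fun _ => (1 : ℝ)
    simp only [smul_eq_mul, mul_one, (hx i).2.1] at this
    simp only [a, this]
    ring
  have hyp : ∀ i, y p i = x i := fun i => by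
    have h1 := hZsum i fun j => (Pi.single j 1 - Pi.single (v i) 1 : Fin N → ℝ)
    rw [sub_self, smul_zero, sub_zero] at h1
    simp only [smul_sub (x i _), sum_sub_distrib, ← sum_smul, (hx i).2.1, one_smul] at h1
    simp only [y, h1, add_sub_cancel]
    ext n
    simp [Finset.sum_apply, Pi.single_apply]
  refine ⟨p, fun i => by rw [hap]; exact (hx i).2.2.1, funext fun n => ?_⟩
  by_cases h : ∃ i, v i = n
  · obtain ⟨i, rfl⟩ := h
    have hW : ∑ j ∈ A i, Z p j • W p j = ∑ j ∈ A i, Z p j • w j := by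
      refine sum_congr rfl fun j hj => ?_
      rw [hZp i j hj]
      split_ifs with h
      · rw [zero_smul, zero_smul]
      · have : j ∈ Vᶜ := by
          simp only [V, mem_compl, mem_image, mem_univ, true_and, not_exists]
          rintro i' rfl
          exact h (by rw [hAeq (hv i') hj])
        simp only [W, dif_pos this, p]
    rw [hΦv, hap, hyp, hW, hZsum, inv_smul_eq_iff₀ (hx i).2.2.1.ne']
    show c - g (x i) - (∑ n, x i n • w n - x i (v i) • w (v i)) = _
    rw [← (hx i).2.2.2]
    abel
  · have hn : n ∈ Vᶜ := by simpa [V] using h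
    simp only [Φ, dif_neg h, W, dif_pos hn, p]

end GeneralPosition

section GeneralPosition

variable {N d : ℕ}

/-- The face of the standard simplex with vertex set `S`. -/
def simplexFace (S : Finset (Fin N)) : Set (Fin N → ℝ) :=
  convexHull ℝ ((fun i => Pi.single i (1 : ℝ)) '' (S : Set (Fin N)))

theorem isCompact_simplexFace (S : Finset (Fin N)) : IsCompact (simplexFace S) :=
  (S.finite_toSet.image _).isCompact_convexHull ℝ

theorem simplexFace_subset_stdSimplex (S : Finset (Fin N)) :
    simplexFace S ⊆ stdSimplex ℝ (Fin N) :=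
  convexHull_min (by rintro _ ⟨i, -, rfl⟩; exact single_mem_stdSimplex ℝ i)
    (convex_stdSimplex ℝ (Fin N))

theorem apply_eq_zero_of_mem_simplexFace {S : Finset (Fin N)} {x : Fin N → ℝ}
    (hx : x ∈ simplexFace S) {n : Fin N} (hn : n ∉ S) : x n = 0 := by
  have h : simplexFace S ⊆ {x | x n = 0} := by
    refine convexHull_min ?_ ?_
    · rintro _ ⟨i, hi, rfl⟩
      have : n ≠ i := fun h => hn (h ▸ hi)
      exact Pi.single_eq_of_ne this _
    · intro x hx y hy a b _ _ _
      simp_all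
  exact h hx

/-- A family of `d + 1` disjoint faces of dimension less than `d` has no common image point. -/
def IsGeneric (g : (Fin N → ℝ) → Fin d → ℝ) : Prop :=
  ∀ A : Fin (d + 1) → Finset (Fin N), (∀ i, #(A i) ≤ d) →
    Pairwise (Function.onFun Disjoint A) → ¬ ∃ c, ∀ i, c ∈ g '' simplexFace (A i)

theorem exists_isGeneric_add (hN : 0 < N) (hd : 0 < d) {g : (Fin N → ℝ) → Fin d → ℝ}
    (hg : ContDiff ℝ 1 g) {r : ℝ} (hr : 0 < r) :
    ∃ w : Fin N → Fin d → ℝ, ‖w‖ < r ∧ IsGeneric fun x => g x + ∑ n, x n • w n := by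
  let ι := {Av : (Fin (d + 1) → Finset (Fin N)) × (Fin (d + 1) → Fin N) // (∀ i, #(Av.1 i) ≤ d) ∧
    Pairwise (Function.onFun Disjoint Av.1) ∧ ∀ i, Av.2 i ∈ Av.1 i}
  let s : ι → Set (Fin N → Fin d → ℝ) := fun a => {w | ∃ (c : Fin d → ℝ)
    (x : Fin (d + 1) → Fin N → ℝ), ∀ i, (∀ n ∉ a.1.1 i, x i n = 0) ∧ ∑ n, x i n = 1 ∧
      0 < x i (a.1.2 i) ∧ g (x i) + ∑ n, x i n • w n = c}
  have hs : dimH (⋃ a, s a) < Module.finrank ℝ (Fin N → Fin d → ℝ) := by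
    have hle : dimH (⋃ a, s a) ≤ ((N * d - 1 : ℕ) : ENNReal) := by
      rw [dimH_iUnion]
      exact iSup_le fun a => dimH_concurrent_le hg a.2.1 a.2.2.1 a.2.2.2
    refine hle.trans_lt ?_
    have : 0 < N * d := by positivity
    simp only [Module.finrank_pi_fintype, Module.finrank_self, sum_const, card_univ,
      Fintype.card_fin, smul_eq_mul, mul_one]
    exact_mod_cast Nat.sub_one_lt this.ne'
  obtain ⟨w, hw, hwr⟩ := (dense_compl_of_dimH_lt_finrank hs).exists_dist_lt 0 hr
  refine ⟨w, by simpa using hwr, ?_⟩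
  rintro A hA hdisj ⟨c, hc⟩
  choose x hx hxc using hc
  have hpos : ∀ i, ∃ n, 0 < x i n := fun i => by
    by_contra! h
    have h1 := (simplexFace_subset_stdSimplex _ (hx i)).2
    have h2 : ∑ n, x i n ≤ 0 := sum_nonpos fun n _ => h n
    linarith
  choose v hv using hpos
  have hvA : ∀ i, v i ∈ A i := fun i => by
    by_contra h
    exact (hv i).ne' (apply_eq_zero_of_mem_simplexFace (hx i) h)
  exact hw (Set.mem_iUnion.2 ⟨⟨(A, v), hA, hdisj, hvA⟩, c, x, fun i =>
    ⟨fun n hn => apply_eq_zero_of_mem_simplexFace (hx i) hn,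
      (simplexFace_subset_stdSimplex _ (hx i)).2, hv i, hxc i⟩⟩)

theorem exists_isGeneric_approx (hN : 0 < N) (hd : 0 < d) {f : (Fin N → ℝ) → Fin d → ℝ}
    (hf : ContinuousOn f (stdSimplex ℝ (Fin N))) {r : ℝ} (hr : 0 < r) :
    ∃ g, Continuous g ∧ IsGeneric g ∧ ∀ x ∈ stdSimplex ℝ (Fin N), dist (f x) (g x) ≤ r := by
  obtain ⟨F, hF⟩ := ContinuousMap.exists_restrict_eq (isClosed_stdSimplex ℝ (Fin N))
    ⟨_, hf.domRestrict⟩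
  have hFf : ∀ x ∈ stdSimplex ℝ (Fin N), F x = f x := fun x hx =>
    DFunLike.congr_fun hF ⟨x, hx⟩
  obtain ⟨g, hg, hgF, -⟩ := F.continuous.exists_contDiff_approx 1
    (ε := fun _ => r / 2) continuous_const (fun _ => half_pos hr)
  obtain ⟨w, hw, hgen⟩ := exists_isGeneric_add hN hd hg (half_pos hr)
  refine ⟨_, ?_, hgen, fun x hx => ?_⟩
  · have := hg.continuous
    fun_prop
  · have h1 : ‖∑ n, x n • w n‖ ≤ r / 2 := calc
      _ ≤ ∑ n, x n * (r / 2) := norm_sum_le_of_le _ fun n _ => by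
        rw [norm_smul, Real.norm_of_nonneg (hx.1 n)]
        exact mul_le_mul_of_nonneg_left ((norm_le_pi_norm w n).trans hw.le) (hx.1 n)
      _ = r / 2 := by rw [← sum_mul, hx.2, one_mul]
    have h2 := hgF x
    rw [hFf x hx] at h2
    calc _ ≤ dist (f x) (g x) + dist (g x) (g x + ∑ n, x n • w n) := dist_triangle _ _ _
      _ ≤ r / 2 + r / 2 := by
        gcongr
        · rw [dist_comm]; exact h2.le
        · rwa [dist_self_add_right]
      _ = r := add_halves r

open Filter Topology in
theorem IsGeneric.exists_pos {g : (Fin N → ℝ) → Fin d → ℝ} (hgen : IsGeneric g)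
    (hg : Continuous g) {r : ℝ} (hr : 0 < r) :
    ∃ ρ > 0, ρ ≤ r ∧ ∀ A : Fin (d + 1) → Finset (Fin N), (∀ i, #(A i) ≤ d) →
      Pairwise (Function.onFun Disjoint A) →
      ∀ c, ∃ i, ∀ x ∈ simplexFace (A i), ρ < dist c (g x) := by
  have h : ∀ᶠ ρ : ℝ in 𝓝[>] 0, ∀ A : Fin (d + 1) → Finset (Fin N), (∀ i, #(A i) ≤ d) →
      Pairwise (Function.onFun Disjoint A) → ∀ c, ∃ i, ∀ y ∈ g '' simplexFace (A i),
      ρ < dist c y := by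
    refine eventually_all.2 fun A => ?_
    by_cases hA : (∀ i, #(A i) ≤ d) ∧ Pairwise (Function.onFun Disjoint A)
    · filter_upwards [eventually_forall_exists_lt_dist
        (fun i => (isCompact_simplexFace (A i)).image hg) (hgen A hA.1 hA.2)] with ρ hρ _ _
      exact hρ
    · exact Eventually.of_forall fun ρ h1 h2 => (hA ⟨h1, h2⟩).elim
  obtain ⟨ρ, hρ, hρ0, hρr⟩ := (h.and (Ioc_mem_nhdsGT hr)).exists
  exact ⟨ρ, hρ0, hρr, fun A h1 h2 c => (hρ A h1 h2 c).imp fun i hi x hx => hi _ ⟨x, hx, rfl⟩⟩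

end GeneralPosition

section Counting

/-- In a family of sets with at most `k` elements there are `m` disjoint members, or there is a set
with at most `m * k` elements that meets all of them. -/
theorem exists_disjoint_or_hitting {α : Type*} [DecidableEq α] (p : Finset α → Prop) {k : ℕ}
    (hp : ∀ B, p B → #B ≤ k) (m : ℕ) :
    (∃ A : Fin m → Finset α, (∀ i, p (A i)) ∧ Pairwise (Function.onFun Disjoint A)) ∨
      ∃ T : Finset α, #T ≤ m * k ∧ ∀ B, p B → ¬ Disjoint B T := by
  induction m with
  | zero => exact Or.inl ⟨Fin.elim0, fun i => i.elim0, fun i => i.elim0⟩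
  | succ m ih =>
    rcases ih with ⟨A, hA, hdisj⟩ | ⟨T, hT, hTB⟩
    · by_cases h : ∀ B, p B → ¬ Disjoint B (univ.biUnion A)
      · refine Or.inr ⟨univ.biUnion A, ?_, h⟩
        have : #(univ.biUnion A) ≤ m * k := by
          simpa using card_biUnion_le_card_mul univ A k fun i _ => hp _ (hA i)
        exact this.trans (Nat.mul_le_mul_right k m.le_succ)
      · push Not at h
        obtain ⟨B, hB, hBA⟩ := h
        rw [disjoint_biUnion_right] at hBA
        refine Or.inl ⟨Fin.cons B A, Fin.cases hB hA, ?_⟩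
        intro i j hij
        induction i using Fin.cases with
        | zero =>
          induction j using Fin.cases with
          | zero => exact (hij rfl).elim
          | succ j => exact hBA j (mem_univ j)
        | succ i =>
          induction j using Fin.cases with
          | zero => exact (hBA i (mem_univ i)).symm
          | succ j => exact hdisj fun h => hij (congrArg Fin.succ h)
    · exact Or.inr ⟨T, hT.trans (Nat.mul_le_mul_right k m.le_succ), hTB⟩

theorem card_filter_exists_mem_mul_le {N : ℕ} (T : Finset (Fin N)) (Q : ℕ) :
    #{t : Fin Q → Fin N | ∃ i, t i ∈ T} * N ≤ Q * #T * N ^ Q := by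
  have hi : ∀ i : Fin Q, #{t : Fin Q → Fin N | t i ∈ T} * N = #T * N ^ Q := fun i => by
    have : ({t : Fin Q → Fin N | t i ∈ T} : Finset _) =
        Fintype.piFinset fun j => if j = i then T else univ := by
      ext t
      simp only [mem_filter, mem_univ, true_and, Fintype.mem_piFinset]
      refine ⟨fun h j => ?_, fun h => by simpa using h i⟩
      split_ifs with hj
      · exact hj ▸ h
      · exact mem_univ _
    obtain ⟨Q, rfl⟩ : ∃ Q', Q = Q' + 1 := ⟨Q - 1, by have := i.2; omega⟩
    rw [this, Fintype.card_piFinset, ← mul_prod_erase univ _ (mem_univ i), if_pos rfl,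
      prod_congr rfl fun j hj => by rw [if_neg (ne_of_mem_erase hj)]]
    simp [pow_succ, mul_assoc]
  have hU : ({t : Fin Q → Fin N | ∃ i, t i ∈ T} : Finset _) =
      univ.biUnion fun i => ({t : Fin Q → Fin N | t i ∈ T} : Finset _) := by
    ext t
    simp
  calc _ ≤ (∑ i : Fin Q, #{t : Fin Q → Fin N | t i ∈ T}) * N := by
        rw [hU]
        gcongr
        exact card_biUnion_le
    _ = _ := by simp [sum_mul, hi, mul_assoc]

theorem nearFace_iff {N d : ℕ} {f : (Fin N → ℝ) → Fin d → ℝ} {ρ : ℝ} {c : Fin d → ℝ} {Q : ℕ}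
    {t : Fin Q → Fin N} :
    NearFace f ρ c t ↔ ∃ x ∈ simplexFace (univ.image t), dist c (f x) ≤ ρ := by
  rw [NearFace, simplexFace, coe_image, coe_univ, Set.image_univ, ← Set.range_comp]
  rfl

open Classical in
theorem card_nearFace_le {N d : ℕ} (hN : 0 < N) {g : (Fin N → ℝ) → Fin d → ℝ} {ρ : ℝ}
    (hg : ∀ A : Fin (d + 1) → Finset (Fin N), (∀ i, #(A i) ≤ d) →
      Pairwise (Function.onFun Disjoint A) → ∀ c, ∃ i, ∀ x ∈ simplexFace (A i), ρ < dist c (g x))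
    (c : Fin d → ℝ) {Q : ℕ} (hQ : Q ≤ d) :
    (#{t : Fin Q → Fin N | NearFace g ρ c t} : ℝ) ≤ d * ((d + 1) * d) / N * (N : ℝ) ^ Q := by
  rcases exists_disjoint_or_hitting
    (fun B => #B ≤ d ∧ ∃ x ∈ simplexFace B, dist c (g x) ≤ ρ) (fun B hB => hB.1) (d + 1) with
    ⟨A, hA, hdisj⟩ | ⟨T, hT, hTB⟩
  · obtain ⟨i, hi⟩ := hg A (fun i => (hA i).1) hdisj c
    obtain ⟨x, hx, hxρ⟩ := (hA i).2
    exact absurd hxρ (hi x hx).not_ge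
  · have h1 : #{t : Fin Q → Fin N | NearFace g ρ c t} ≤ #{t : Fin Q → Fin N | ∃ i, t i ∈ T} := by
      refine card_le_card fun t ht => ?_
      simp only [mem_filter, mem_univ, true_and] at ht ⊢
      have := hTB (univ.image t) ⟨card_image_le.trans (by simpa using hQ), nearFace_iff.1 ht⟩
      obtain ⟨n, hn, hnT⟩ := not_disjoint_iff.1 this
      obtain ⟨i, -, rfl⟩ := mem_image.1 hn
      exact ⟨i, hnT⟩
    have h2 : #{t : Fin Q → Fin N | NearFace g ρ c t} * N ≤ d * ((d + 1) * d) * N ^ Q :=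
      (Nat.mul_le_mul_right N h1).trans
        ((card_filter_exists_mem_mul_le T Q).trans (by gcongr))
    rw [div_mul_eq_mul_div, le_div_iff₀ (by exact_mod_cast hN)]
    exact_mod_cast h2

end Counting

section TuplesToSets

theorem card_filter_not_injective_le (N n : ℕ) :
    #{t : Fin (n + 1) → Fin N | ¬ Function.Injective t} ≤ (n + 1) * n * N ^ n := by
  classical
  have hcard : ∀ (i : Fin (n + 1)) (j : Fin n),
      #{t : Fin (n + 1) → Fin N | t i = t (i.succAbove j)} ≤ N ^ n := fun i j => by
    have h : #{t : Fin (n + 1) → Fin N | t i = t (i.succAbove j)} ≤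
        #(univ : Finset (Fin n → Fin N)) := by
      refine card_le_card_of_injOn (fun t => i.removeNth t) (fun _ _ => mem_univ _) ?_
      intro t ht t' ht' h
      simp only [coe_filter, mem_univ, true_and, Set.mem_ofPred_eq] at ht ht'
      have h' : ∀ k, t (i.succAbove k) = t' (i.succAbove k) := fun k => congrFun h k
      ext k : 1
      induction k using i.succAboveCases with
      | x => rw [ht, ht', h']
      | p k => exact h' k
    simpa using h
  calc _ ≤ #((univ : Finset (Fin (n + 1) × Fin n)).biUnion fun ij =>
        ({t : Fin (n + 1) → Fin N | t ij.1 = t (ij.1.succAbove ij.2)} : Finset _)) := by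
        refine card_le_card fun t ht => ?_
        obtain ⟨i, j, hij, hne⟩ := Function.not_injective_iff.1 (mem_filter.1 ht).2
        obtain ⟨k, rfl⟩ := Fin.exists_succAbove_eq hne.symm
        exact mem_biUnion.2 ⟨(i, k), mem_univ _, by simpa using hij⟩
    _ ≤ _ := by
        refine (card_biUnion_le_card_mul _ _ _ fun ij _ => hcard ij.1 ij.2).trans_eq ?_
        simp

open Classical in
theorem card_filter_image_le (N n : ℕ) (p : Finset (Fin N) → Prop) :
    #{t : Fin (n + 1) → Fin N | p (univ.image t)} ≤
      (n + 1).factorial * #{S : Finset (Fin N) | #S = n + 1 ∧ p S} + (n + 1) * n * N ^ n := by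
  rw [← card_filter_add_card_filter_not (fun t : Fin (n + 1) → Fin N => Function.Injective t)]
  refine add_le_add ?_ ((card_le_card ?_).trans (card_filter_not_injective_le N n))
  · refine card_le_mul_card_image_of_maps_to (f := fun t => univ.image t) (fun t ht => ?_) _
      (fun S hS => ?_)
    · simp only [mem_filter, mem_univ, true_and] at ht ⊢
      exact ⟨by simp [card_image_of_injective _ ht.2], ht.1⟩
    · simp only [mem_filter, mem_univ, true_and] at hS
      have hemb : #(univ : Finset (Fin (n + 1) ↪ S)) = (n + 1).factorial := by
        rw [card_univ, Fintype.card_embedding_eq, Fintype.card_coe, Fintype.card_fin, hS.1,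
          Nat.descFactorial_self]
      rw [← hemb]
      refine card_le_card_of_surjOn (fun e i => (e i : Fin N)) fun t ht => ?_
      simp only [coe_filter, mem_filter, mem_univ, true_and, Set.mem_ofPred_eq] at ht
      obtain ⟨⟨-, hinj⟩, himg⟩ := ht
      exact ⟨⟨fun i => ⟨t i, himg ▸ mem_image_of_mem t (mem_univ i)⟩,
        fun i j h => hinj (congrArg Subtype.val h)⟩, by simp, rfl⟩
  · intro t ht
    simp only [mem_filter, mem_univ, true_and] at ht ⊢
    exact ht.2

end TuplesToSets

section Main
open Filter Topology

/-- The constant of the heavily covered point theorem in dimension `D + 1`. -/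
noncomputable def gromovConst (D : ℕ) : ℝ :=
  2 * (D + 1) / ((D + 2).factorial * (D + 2))

theorem exists_numerics (D : ℕ) {ε : ℝ} (hε : 0 < ε) :
    ∃ η₀ > 0, ∃ β : ℝ, ∀ η ≤ η₀, η + (D + 2) * β < 1 ∧
      ∀ b : ℝ, b ≤ 1 / 2 → 2 * b * (1 - b) ≤
        (D + 1).factorial * (gromovConst D - ε + D * η) → b ≤ β := by
  have hfac : (0 : ℝ) < (D + 1).factorial := by positivity
  obtain ⟨x, hx⟩ : ∃ x : ℝ, x = 1 / (D + 2) := ⟨_, rfl⟩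
  have hx0 : 0 < x := by rw [hx]; positivity
  have hx2 : x ≤ 1 / 2 := by
    rw [hx]
    gcongr
    linarith [(Nat.cast_nonneg D : (0 : ℝ) ≤ D)]
  have hconst : (D + 1).factorial * gromovConst D = 2 * x * (1 - x) := by
    rw [gromovConst, hx, Nat.factorial_succ (D + 1)]
    push_cast
    field_simp
    ring
  obtain ⟨γ, hγ⟩ : ∃ γ : ℝ, γ = (D + 1).factorial * ε / 2 := ⟨_, rfl⟩
  have hγ0 : 0 < γ := by rw [hγ]; positivity
  obtain ⟨e, he0, he1, heγ⟩ : ∃ e > 0, e ≤ 1 ∧ 4 * e ≤ γ :=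
    ⟨min 1 (γ / 4), by positivity, min_le_left _ _, by linarith [min_le_right 1 (γ / 4)]⟩
  refine ⟨min e (ε / (2 * (D + 1))), by positivity, x - e, fun η hη => ⟨?_, fun b hb hle => ?_⟩⟩
  · have h1 : (D + 2) * x = 1 := by rw [hx]; field_simp
    have h2 : η ≤ e := hη.trans (min_le_left _ _)
    have h3 : 0 ≤ D * e := by positivity
    nlinarith
  · have h1 : D * η ≤ ε / 2 := calc
      D * η ≤ D * (ε / (2 * (D + 1))) := by gcongr; exact hη.trans (min_le_right _ _)
      _ ≤ (D + 1) * (ε / (2 * (D + 1))) := by gcongr; linarith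
      _ = ε / 2 := by field_simp
    have h2 : (D + 1).factorial * (gromovConst D - ε + D * η) ≤ 2 * x * (1 - x) - γ := by
      rw [← hconst, hγ]
      nlinarith
    by_contra! hlt
    nlinarith [mul_pos (sub_pos.2 hlt) (show 0 < 1 - b - (x - e) by linarith)]

open Classical in
theorem exists_card_nearFace_gt_gromovConst (D : ℕ) {ε : ℝ} (hε : 0 < ε) :
    ∃ N₀ : ℕ, ∀ N, N₀ ≤ N → ∀ f : (Fin N → ℝ) → Fin (D + 1) → ℝ,
      ContinuousOn f (stdSimplex ℝ (Fin N)) → ∀ r > 0, ∃ c,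
        (gromovConst D - ε) * (N : ℝ) ^ (D + 2) <
          #{t : Fin (D + 2) → Fin N | NearFace f r c t} := by
  obtain ⟨η₀, hη₀, β, hβ⟩ := exists_numerics D hε
  obtain ⟨N₁, hN₁⟩ := exists_nat_gt (((D + 1 : ℕ) : ℝ) * (((D + 1 : ℕ) + 1) * (D + 1 : ℕ)) / η₀)
  refine ⟨N₁ + 1, fun N hN f hf r hr => ?_⟩
  have hN0 : 0 < N := by omega
  obtain ⟨g, hg, hgen, hgf⟩ := exists_isGeneric_approx hN0 D.succ_pos hf (half_pos hr)
  obtain ⟨ρ, hρ, hρr, hgρ⟩ := hgen.exists_pos hg (half_pos hr)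
  have hηN : ((D + 1 : ℕ) : ℝ) * (((D + 1 : ℕ) + 1) * (D + 1 : ℕ)) / N ≤ η₀ := by
    have : (N₁ : ℝ) ≤ N := by exact_mod_cast (by omega : N₁ ≤ N)
    rw [div_lt_iff₀ hη₀] at hN₁
    rw [div_le_iff₀ (by exact_mod_cast hN0)]
    nlinarith
  obtain ⟨h1, h2⟩ := hβ _ hηN
  obtain ⟨c, hc⟩ := exists_card_nearFace_gt hN0 hg.continuousOn (half_pos hρ) (by positivity) h1 h2
    fun c Q hQ => by
      rw [mul_div_cancel₀ ρ two_ne_zero]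
      exact card_nearFace_le hN0 hgρ c hQ
  refine ⟨c, hc.trans_le ?_⟩
  rw [mul_div_cancel₀ ρ two_ne_zero]
  gcongr with t _
  rintro ⟨x, hx, hxρ⟩
  refine ⟨x, hx, ?_⟩
  have := hgf x (convexHull_single_subset_stdSimplex t hx)
  rw [dist_comm] at this
  linarith [dist_triangle c (g x) (f x)]

open Classical in
theorem exists_card_simplexFace_near_ge (D : ℕ) {ε : ℝ} (hε : 0 < ε) :
    ∃ N₀ : ℕ, ∀ N, N₀ ≤ N → ∀ f : (Fin N → ℝ) → Fin (D + 1) → ℝ,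
      ContinuousOn f (stdSimplex ℝ (Fin N)) → ∀ r > 0, ∃ c,
        (gromovConst D - ε) * (N.choose (D + 2) : ℝ) ≤ #{S : Finset (Fin N) |
          #S = D + 2 ∧ ∃ x ∈ simplexFace S, dist c (f x) ≤ r} := by
  obtain ⟨N₁, hN₁⟩ := exists_card_nearFace_gt_gromovConst D (half_pos hε)
  obtain ⟨N₂, hN₂⟩ := exists_nat_gt ((D + 2) * (D + 1) / (ε / 2))
  refine ⟨max N₁ N₂, fun N hN f hf r hr => ?_⟩
  obtain ⟨c, hc⟩ := hN₁ N ((le_max_left _ _).trans hN) f hf r hr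
  refine ⟨c, ?_⟩
  rcases le_or_gt (gromovConst D - ε) 0 with hneg | hpos
  · exact (mul_nonpos_of_nonpos_of_nonneg hneg (by positivity)).trans (by positivity)
  have hN2 : (D + 2) * (D + 1) ≤ ε / 2 * N := by
    have : (N₂ : ℝ) ≤ N := by exact_mod_cast (le_max_right _ _).trans hN
    rw [div_lt_iff₀ (by positivity)] at hN₂
    nlinarith
  simp only [nearFace_iff] at hc
  have hle : (#{t : Fin (D + 2) → Fin N |
      ∃ x ∈ simplexFace (univ.image t), dist c (f x) ≤ r} : ℝ) ≤
      (D + 2).factorial * #{S : Finset (Fin N) |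
        #S = D + 2 ∧ ∃ x ∈ simplexFace S, dist c (f x) ≤ r} + (D + 2) * (D + 1) * N ^ (D + 1) := by
    exact_mod_cast card_filter_image_le N (D + 1)
      fun S => ∃ x ∈ simplexFace S, dist c (f x) ≤ r
  have hchoose : (N.choose (D + 2) : ℝ) ≤ N ^ (D + 2) / (D + 2).factorial :=
    Nat.choose_le_pow_div _ _
  have hfac : (0 : ℝ) < (D + 2).factorial := by positivity
  calc _ ≤ (gromovConst D - ε) * (N ^ (D + 2) / (D + 2).factorial) := by gcongr
    _ ≤ _ := by
      rw [← mul_div_assoc, div_le_iff₀ hfac]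
      have h3 : (D + 2) * (D + 1) * (N : ℝ) ^ (D + 1) ≤ ε / 2 * N ^ (D + 2) := by
        rw [pow_succ _ (D + 1)]
        nlinarith [pow_nonneg (Nat.cast_nonneg N : (0 : ℝ) ≤ N) (D + 1)]
      linarith

theorem exists_card_simplexFace_ge (D : ℕ) {ε : ℝ} (hε : 0 < ε) :
    ∃ N₀ : ℕ, ∀ N, N₀ ≤ N → ∀ f : (Fin N → ℝ) → Fin (D + 1) → ℝ,
      ContinuousOn f (stdSimplex ℝ (Fin N)) → ∃ c,
        (gromovConst D - ε) * (N.choose (D + 2) : ℝ) ≤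
          ({S : Finset (Fin N) | #S = D + 2 ∧ c ∈ f '' simplexFace S}.ncard : ℝ) := by
  classical
  obtain ⟨N₀, hN₀⟩ := exists_card_simplexFace_near_ge D hε
  refine ⟨N₀, fun N hN f hf => ?_⟩
  by_contra! hcon
  have h : ∀ᶠ r : ℝ in 𝓝[>] 0, ∀ 𝒮 : Finset (Finset (Fin N)), (∀ S ∈ 𝒮, #S = D + 2) →
      (gromovConst D - ε) * (N.choose (D + 2) : ℝ) ≤ #𝒮 →
      ∀ c, ∃ S : 𝒮, ∀ y ∈ f '' simplexFace S.1, r < dist c y := by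
    refine eventually_all.2 fun 𝒮 => ?_
    by_cases h𝒮 : (∀ S ∈ 𝒮, #S = D + 2) ∧ (gromovConst D - ε) * (N.choose (D + 2) : ℝ) ≤ #𝒮
    · have hne : ¬ ∃ c, ∀ S : 𝒮, c ∈ f '' simplexFace S.1 := by
        rintro ⟨c, hc⟩
        refine (hcon c).not_ge (h𝒮.2.trans ?_)
        have hsub : (𝒮 : Set (Finset (Fin N))) ⊆ {S | #S = D + 2 ∧ c ∈ f '' simplexFace S} :=
          fun S hS => ⟨h𝒮.1 S hS, hc ⟨S, hS⟩⟩
        rw [← Set.ncard_coe_finset]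
        exact_mod_cast Set.ncard_le_ncard hsub (Set.toFinite _)
      filter_upwards [eventually_forall_exists_lt_dist (fun S : 𝒮 =>
        (isCompact_simplexFace S.1).image_of_continuousOn
          (hf.mono (simplexFace_subset_stdSimplex S.1))) hne] with r hr _ _
      exact hr
    · exact Eventually.of_forall fun r h1 h2 => (h𝒮 ⟨h1, h2⟩).elim
  obtain ⟨r, hr, hr0⟩ := (h.and self_mem_nhdsWithin).exists
  obtain ⟨c, hc⟩ := hN₀ N hN f hf r hr0
  obtain ⟨⟨S, hS⟩, hSr⟩ := hr _ (fun S hS => (mem_filter.1 hS).2.1) hc c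
  obtain ⟨x, hx, hxr⟩ := (mem_filter.1 hS).2.2
  exact (hSr _ ⟨x, hx, rfl⟩).not_ge hxr

end Main

/-- **Gromov's heavily covered point theorem.**
For every `d ≥ 1` and `ε > 0` there is `N₀` such that for every `N ≥ N₀` and every
continuous map `f` from the standard `(N-1)`-simplex (the convex hull of the standard
basis vectors of `ℝ^N`) to `ℝ^d`, some point `c ∈ ℝ^d` lies in the `f`-image of at least
`(2d/((d+1)!(d+1)) - ε) · C(N, d+1)` of the `d`-dimensional faces of the simplex. -/
theorem gromov_heavily_covered_point (d : ℕ) (hd : 1 ≤ d) (ε : ℝ) (hε : 0 < ε) :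
    ∃ N₀ : ℕ, ∀ N : ℕ, N₀ ≤ N →
      ∀ f : (Fin N → ℝ) → EuclideanSpace ℝ (Fin d),
        ContinuousOn f (stdSimplex ℝ (Fin N)) →
        ∃ c : EuclideanSpace ℝ (Fin d),
          ((2 * (d : ℝ)) / ((Nat.factorial (d + 1) : ℝ) * ((d : ℝ) + 1)) - ε) *
              (N.choose (d + 1) : ℝ) ≤
            (({S : Finset (Fin N) | S.card = d + 1 ∧
                c ∈ f '' (convexHull ℝ
                  ((fun i => Pi.single i (1 : ℝ)) '' (S : Set (Fin N))))}).ncard : ℝ) := by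
  obtain ⟨D, rfl⟩ : ∃ D, d = D + 1 := ⟨d - 1, by omega⟩
  obtain ⟨N₀, hN₀⟩ := exists_card_simplexFace_ge D hε
  refine ⟨N₀, fun N hN f hf => ?_⟩
  obtain ⟨c, hc⟩ := hN₀ N hN (fun x => WithLp.ofLp (f x))
    ((PiLp.continuous_ofLp 2 _).comp_continuousOn hf)
  have hconst : (2 * ((D + 1 : ℕ) : ℝ)) / (((D + 1 + 1).factorial : ℝ) * (((D + 1 : ℕ) : ℝ) + 1)) =
      gromovConst D := by
    rw [gromovConst]
    push_cast
    ring_nf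
  refine ⟨WithLp.toLp 2 c, ?_⟩
  rw [hconst]
  convert hc using 5 with S
  refine and_congr_right fun _ => exists_congr fun x => and_congr_right fun _ => ?_
  exact ⟨fun h => congrArg WithLp.ofLp h, fun h => congrArg (WithLp.toLp 2) h⟩
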